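/- Under the standing assumptions, and with E_0 a constant as specified, there exists L_1 > 0 such that for every natural number L > L_1 and every ε > 0 there exists λ > 1 with #(V_{L,3ε}(n) \ W_{L,ε}(n)) / #B_S(n) ≤ λ^{−n} for all sufficiently large n. -/

import Mathlib

namespace AcylCount

/-! ### Geodesic segments and Gromov hyperbolicity -/

/-- A finite geodesic segment in a metric space, parametrized by arclength on `[0, len]`,
oriented from `initial := toFun 0` to `terminal := toFun len`. -/
structure GeodesicSegment (X : Type*) [MetricSpace X] where
  len : ℝ
  len_nonneg : 0 ≤ len
  toFun : ℝ → X
  isom : ∀ s ∈ Set.Icc (0:ℝ) len, ∀ t ∈ Set.Icc (0:ℝ) len,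
    dist (toFun s) (toFun t) = |s - t|

namespace GeodesicSegment

variable {X : Type*} [MetricSpace X]

/-- The initial point of a geodesic segment. -/
def initial (γ : GeodesicSegment X) : X := γ.toFun 0

/-- The terminal point of a geodesic segment. -/
def terminal (γ : GeodesicSegment X) : X := γ.toFun γ.len

/-- The image (underlying set) of a geodesic segment. -/
def seg (γ : GeodesicSegment X) : Set X := γ.toFun '' Set.Icc 0 γ.len

/-- The translate of a geodesic segment by an isometry. -/
def translate (γ : GeodesicSegment X) (f : X → X) (hf : Isometry f) :
    GeodesicSegment X where
  len := γ.len
  len_nonneg := γ.len_nonneg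
  toFun := f ∘ γ.toFun
  isom := fun s hs t ht => by
    simp only [Function.comp_apply, hf.dist_eq]
    exact γ.isom s hs t ht

/-- The degenerate geodesic segment consisting of a single point. -/
def point (p : X) : GeodesicSegment X where
  len := 0
  len_nonneg := le_refl 0
  toFun := fun _ => p
  isom := fun s hs t ht => by
    have hs0 : s = 0 := le_antisymm hs.2 hs.1
    have ht0 : t = 0 := le_antisymm ht.2 ht.1
    simp [hs0, ht0]

/-- `η` is a subsegment of `γ`. -/
def IsSubsegment (η γ : GeodesicSegment X) : Prop :=
  ∃ a b : ℝ, 0 ≤ a ∧ a ≤ b ∧ b ≤ γ.len ∧ η.len = b - a ∧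
    ∀ t ∈ Set.Icc (0:ℝ) η.len, η.toFun t = γ.toFun (a + t)

/-- `p` occurs (weakly) before `q` along the oriented geodesic segment `γ`. -/
def Before (γ : GeodesicSegment X) (p q : X) : Prop :=
  ∃ s t : ℝ, s ∈ Set.Icc (0:ℝ) γ.len ∧ t ∈ Set.Icc (0:ℝ) γ.len ∧ s ≤ t ∧
    γ.toFun s = p ∧ γ.toFun t = q

end GeodesicSegment

/-- A geodesic metric space: every two points are joined by a geodesic segment. -/
def IsGeodesicSpace (X : Type*) [MetricSpace X] : Prop :=
  ∀ x y : X, ∃ γ : GeodesicSegment X, γ.initial = x ∧ γ.terminal = y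

/-- δ-hyperbolicity via slim triangles: each side of a geodesic triangle lies in the
closed δ-neighborhood of the union of the other two sides. -/
def IsDeltaHyperbolic (X : Type*) [MetricSpace X] (δ : ℝ) : Prop :=
  ∀ γ₁ γ₂ γ₃ : GeodesicSegment X,
    γ₁.initial = γ₃.initial → γ₁.terminal = γ₂.initial → γ₂.terminal = γ₃.terminal →
    γ₃.seg ⊆ Metric.cthickening δ (γ₁.seg ∪ γ₂.seg)

variable {X : Type*} [MetricSpace X]

/-- The closest point projection of `x` to (the image of) the geodesic `γ`. -/
def proj (γ : GeodesicSegment X) (x : X) : Set X :=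
  {p | p ∈ γ.seg ∧ dist x p = Metric.infDist x γ.seg}

/-- The closest point projection of a set `A` to the geodesic `γ`. -/
def projSet (γ : GeodesicSegment X) (A : Set X) : Set X :=
  ⋃ a ∈ A, proj γ a

/-- The ordered pair of oriented geodesic segments `(γ, η)` is `K`-aligned. -/
def AlignedPair (K : ℝ) (γ η : GeodesicSegment X) : Prop :=
  Metric.diam (projSet γ η.seg ∪ {γ.terminal}) < K ∧
  Metric.diam (projSet η γ.seg ∪ {η.initial}) < K

/-- A sequence of oriented geodesic segments is `K`-aligned if each consecutive
pair is `K`-aligned. -/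
def AlignedSeq (K : ℝ) (l : List (GeodesicSegment X)) : Prop :=
  l.Chain' (AlignedPair K)

/-- The Gromov product `(y, z)_x`. -/
noncomputable def gromovProd (x y z : X) : ℝ := (dist y x + dist x z - dist y z) / 2

/-! ### Word metric -/

variable {G : Type*} [Group G]

/-- The word length of `g` with respect to the (symmetrized) generating set `S`. -/
noncomputable def wordLength (S : Finset G) (g : G) : ℕ :=
  sInf {n | ∃ l : List G, l.length = n ∧ (∀ x ∈ l, x ∈ S ∨ x⁻¹ ∈ S) ∧ l.prod = g}

/-- The word metric on `G` with respect to `S`. -/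
noncomputable def wordDist (S : Finset G) (g h : G) : ℕ := wordLength S (g⁻¹ * h)

/-- The ball of radius `r` in the word metric, centered at the identity. -/
def ball (S : Finset G) (r : ℝ) : Set G := {g | (wordLength S g : ℝ) ≤ r}

/-- `G` has no cyclic subgroup of finite index. -/
def NonVirtuallyCyclic (G : Type*) [Group G] : Prop :=
  ¬ ∃ H : Subgroup G, H.FiniteIndex ∧ IsCyclic H

/-! ### Isometric actions, loxodromics, WPD -/

/-- `g` is a loxodromic isometry for the action `ρ` with basepoint `x0`: the asymptotic
translation length `τ_X(g) = lim dist x0 (g^n x0) / n` exists and is positive. -/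
def IsLoxodromic (ρ : G → X → X) (x0 : X) (g : G) : Prop :=
  ∃ τ : ℝ, 0 < τ ∧
    Filter.Tendsto (fun n : ℕ => dist x0 (ρ (g ^ n) x0) / n) Filter.atTop (nhds τ)

/-- The WPD (weak proper discontinuity) property of `g` for the action `ρ` with
basepoint `x0`. -/
def HasWPD (ρ : G → X → X) (x0 : X) (g : G) : Prop :=
  ∀ K : ℝ, 0 < K → ∃ N M : ℕ,
    {h : G | dist x0 (ρ h x0) < K ∧ dist (ρ (g ^ N) x0) (ρ h (ρ (g ^ N) x0)) < K}.Finite ∧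
    {h : G | dist x0 (ρ h x0) < K ∧ dist (ρ (g ^ N) x0) (ρ h (ρ (g ^ N) x0)) < K}.ncard < M

/-- The list of translated geodesics `h 1 • Υ, …, h m • Υ`. -/
def transList (ρ : G → X → X) (hisom : ∀ g : G, Isometry (ρ g))
    (Υ : GeodesicSegment X) (h : ℕ → G) (m : ℕ) : List (GeodesicSegment X) :=
  (List.range m).map fun i => Υ.translate (ρ (h (i + 1))) (hisom _)

/-- The specification of the constant `E₀` from Fact 2.7 (Bestvina–Fujiwara):
(i) Gromov product bounds, (ii) the WPD-type conclusion for large projections. -/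
def E0Spec (S : Finset G) (ρ : G → X → X) (x0 : X) (φ : G) (E0 : ℝ) : Prop :=
  0 < E0 ∧
  (∀ g : G, ∃ s t : G, (s ∈ S ∨ s = 1) ∧ (t ∈ S ∨ t = 1) ∧
    (∀ i : ℤ, 0 < i → gromovProd x0 (ρ (φ ^ i) x0) (ρ (s * g) x0) ≤ E0) ∧
    (∀ j : ℤ, j < 0 → gromovProd x0 (ρ (φ ^ j) x0) (ρ (t * g) x0) ≤ E0)) ∧
  (∀ n : ℕ, 0 < n → ∀ g : G, ∀ γ : GeodesicSegment X,
    γ.initial = x0 → γ.terminal = ρ (φ ^ n) x0 →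
    ∀ p ∈ proj γ (ρ g x0), ∀ q ∈ proj γ (ρ (g * φ ^ n) x0),
      γ.Before p q → E0 < dist p q →
      ∃ i j : ℕ, i ≤ n ∧ j ≤ n ∧ (wordDist S (φ ^ i) (g * φ ^ j) : ℝ) < E0)

/-- The set `V_{L,ε}(n)`. Here `Υ` is the chosen geodesic `Υ_L = [x₀, φ^L x₀]`. -/
def Vset (S : Finset G) (ρ : G → X → X) (hisom : ∀ g : G, Isometry (ρ g)) (x0 : X)
    (δ E0 : ℝ) (Υ : GeodesicSegment X) (ε : ℝ) (n : ℕ) : Set G :=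
  {g | g ∈ ball S (n:ℝ) ∧ ∃ h : ℕ → G,
    AlignedSeq (6 * E0 + 300 * δ)
      ([GeodesicSegment.point x0] ++ transList ρ hisom Υ h ⌈ε * (n:ℝ)⌉₊ ++
        [GeodesicSegment.point (ρ g x0)])}

/-- The set `W_{L,ε}(n)`. Here `Υ` is the chosen geodesic `Υ_L = [x₀, φ^L x₀]`. -/
def Wset (S : Finset G) (ρ : G → X → X) (hisom : ∀ g : G, Isometry (ρ g)) (x0 : X)
    (δ E0 : ℝ) (Υ : GeodesicSegment X) (ε : ℝ) (n : ℕ) : Set G :=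
  {g | g ∈ ball S (n:ℝ) ∧ ∃ h : ℕ → G,
    AlignedSeq (6 * E0 + 360 * δ)
      ([GeodesicSegment.point x0] ++ transList ρ hisom Υ h ⌈ε * (n:ℝ)⌉₊ ++
        [GeodesicSegment.point (ρ g x0)]) ∧
    AlignedPair (6 * E0 + 360 * δ) (GeodesicSegment.point (ρ g⁻¹ x0))
      (Υ.translate (ρ (h 1)) (hisom _)) ∧
    AlignedPair (6 * E0 + 360 * δ) (Υ.translate (ρ (h ⌈ε * (n:ℝ)⌉₊)) (hisom _))
      (GeodesicSegment.point (ρ (g ^ 2) x0))}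

/-- The set `BAD_{L,ε}(n)`. -/
def BADset (S : Finset G) (ρ : G → X → X) (hisom : ∀ g : G, Isometry (ρ g)) (x0 : X)
    (δ E0 : ℝ) (Υ : GeodesicSegment X) (ε : ℝ) (n : ℕ) : Set G :=
  ball S (n:ℝ) \ (ball S ((⌊(0.9:ℝ) * (n:ℝ)⌋₊ : ℕ) : ℝ) ∪ Vset S ρ hisom x0 δ E0 Υ ε n)

/-! ### Paths in the word metric -/

/-- `P` is a `d_S`-path connecting `a` to `b`. -/
noncomputable def IsPathFrom (S : Finset G) (P : List G) (a b : G) : Prop :=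
  P ≠ [] ∧ P.Chain' (fun u v => wordDist S u v = 1) ∧ P.head? = some a ∧ P.getLast? = some b

/-- The distance `d_S(P, g)` from a path `P` to a group element `g`. -/
noncomputable def pathDist (S : Finset G) (P : List G) (g : G) : ℕ :=
  sInf {d | ∃ v ∈ P, d = wordDist S v g}


/-! ### Segments, the four-point inequality and closest point parameters -/

namespace GeodesicSegment

theorem continuousOn_toFun (γ : GeodesicSegment X) :
    ContinuousOn γ.toFun (Set.Icc 0 γ.len) := by
  refine LipschitzOnWith.continuousOn (K := 1) ?_
  refine LipschitzOnWith.of_dist_le_mul fun s hs t ht => ?_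
  rw [γ.isom s hs t ht, Real.dist_eq]
  simp

theorem isCompact_seg (γ : GeodesicSegment X) : IsCompact γ.seg :=
  isCompact_Icc.image_of_continuousOn γ.continuousOn_toFun

theorem zero_mem (γ : GeodesicSegment X) : (0 : ℝ) ∈ Set.Icc (0 : ℝ) γ.len :=
  ⟨le_refl 0, γ.len_nonneg⟩

theorem len_mem (γ : GeodesicSegment X) : γ.len ∈ Set.Icc (0 : ℝ) γ.len :=
  ⟨γ.len_nonneg, le_refl _⟩

theorem dist_initial_terminal (γ : GeodesicSegment X) :
    dist γ.initial γ.terminal = γ.len := by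
  unfold initial terminal
  rw [γ.isom 0 γ.zero_mem _ γ.len_mem, zero_sub, abs_neg, abs_of_nonneg γ.len_nonneg]

theorem dist_initial_add_dist_terminal (γ : GeodesicSegment X) {v : X} (hv : v ∈ γ.seg) :
    dist γ.initial v + dist v γ.terminal = dist γ.initial γ.terminal := by
  obtain ⟨t, ht, rfl⟩ := hv
  rw [γ.dist_initial_terminal]
  unfold initial terminal
  rw [γ.isom 0 γ.zero_mem t ht, γ.isom t ht _ γ.len_mem, zero_sub, abs_neg,
    abs_of_nonneg ht.1, abs_of_nonpos (by linarith [ht.2])]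
  ring

/-- The same segment with the opposite orientation. -/
def reverse (γ : GeodesicSegment X) : GeodesicSegment X where
  len := γ.len
  len_nonneg := γ.len_nonneg
  toFun := fun t => γ.toFun (γ.len - t)
  isom := fun s hs t ht => by
    rw [γ.isom _ ⟨by linarith [hs.2], by linarith [hs.1]⟩ _
      ⟨by linarith [ht.2], by linarith [ht.1]⟩, abs_sub_comm]
    congr 1
    ring

end GeodesicSegment

/-- The four-point inequality with additive error `6 * δ`. -/
def FourPoint (X : Type*) [MetricSpace X] (δ : ℝ) : Prop :=
  ∀ x y z w : X,
    dist x y + dist z w ≤ max (dist x z + dist y w) (dist x w + dist y z) + 6 * δ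

theorem exists_dist_le_of_mem_cthickening {δ : ℝ} (hδ : 0 < δ) {γ : GeodesicSegment X} {v : X}
    (hv : v ∈ Metric.cthickening δ γ.seg) : ∃ u ∈ γ.seg, dist v u ≤ δ := by
  rw [γ.isCompact_seg.cthickening_eq_biUnion_closedBall hδ.le] at hv
  simpa using hv

theorem IsDeltaHyperbolic.fourPoint {δ : ℝ} (hδ : 0 < δ) (hgeo : IsGeodesicSpace X)
    (hhyp : IsDeltaHyperbolic X δ) : FourPoint X δ := by
  intro x w y z
  obtain ⟨α, hα0, hα1⟩ := hgeo y z
  obtain ⟨β, hβ0, hβ1⟩ := hgeo y x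
  obtain ⟨β', hβ'0, hβ'1⟩ := hgeo x z
  obtain ⟨σ, hσ0, hσ1⟩ := hgeo y w
  obtain ⟨σ', hσ'0, hσ'1⟩ := hgeo w z
  have hx := hhyp β β' α (by rw [hβ0, hα0]) (by rw [hβ1, hβ'0]) (by rw [hβ'1, hα1])
  have hw := hhyp σ σ' α (by rw [hσ0, hα0]) (by rw [hσ1, hσ'0]) (by rw [hσ'1, hα1])
  rw [Metric.cthickening_union] at hx hw
  have hpre : IsPreconnected α.seg :=
    (isPreconnected_Icc).image _ α.continuousOn_toFun
  obtain ⟨v, hvα, hv1, hv2⟩ := isPreconnected_closed_iff.1 hpre _ _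
    Metric.isClosed_cthickening Metric.isClosed_cthickening hx
    ⟨y, ⟨0, α.zero_mem, hα0⟩,
      Metric.self_subset_cthickening _ ⟨0, β.zero_mem, hβ0⟩⟩
    ⟨z, ⟨α.len, α.len_mem, hα1⟩,
      Metric.self_subset_cthickening _ ⟨β'.len, β'.len_mem, hβ'1⟩⟩
  obtain ⟨u, hu, hvu⟩ := exists_dist_le_of_mem_cthickening hδ hv1
  obtain ⟨u', hu', hvu'⟩ := exists_dist_le_of_mem_cthickening hδ hv2
  have e1 := β.dist_initial_add_dist_terminal hu
  have e2 := β'.dist_initial_add_dist_terminal hu'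
  have e3 := α.dist_initial_add_dist_terminal hvα
  rw [hβ0, hβ1] at e1
  rw [hβ'0, hβ'1] at e2
  rw [hα0, hα1] at e3
  have t1 := dist_triangle y u v
  have t2 := dist_triangle x u v
  have t3 := dist_triangle x u' v
  have t4 := dist_triangle v u' z
  have key : 2 * dist x v + dist y z ≤ dist x y + dist x z + 4 * δ := by
    rw [dist_comm u v, dist_comm u x] at *
    linarith [dist_comm u' v, dist_comm x y, dist_comm v u, dist_comm u x,
      dist_triangle y u v, dist_triangle x u v]
  rcases hw hvα with h | h
  · obtain ⟨q, hq, hvq⟩ := exists_dist_le_of_mem_cthickening hδ h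
    have e4 := σ.dist_initial_add_dist_terminal hq
    rw [hσ0, hσ1] at e4
    have : dist x w + dist y z ≤ dist x z + dist w y + 6 * δ := by
      linarith [dist_triangle x v q, dist_triangle x q w, dist_triangle x q y,
        dist_comm y q, dist_comm w y]
    linarith [le_max_right (dist x y + dist w z) (dist x z + dist w y)]
  · obtain ⟨q, hq, hvq⟩ := exists_dist_le_of_mem_cthickening hδ h
    have e4 := σ'.dist_initial_add_dist_terminal hq
    rw [hσ'0, hσ'1] at e4
    have : dist x w + dist y z ≤ dist x y + dist w z + 6 * δ := by
      linarith [dist_triangle x v q, dist_triangle x q w, dist_triangle x q z,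
        dist_comm w q, dist_comm w z]
    linarith [le_max_left (dist x y + dist w z) (dist x z + dist w y)]

/-- `t` is the parameter of a closest point projection of `x` to `γ`. -/
structure IsProj (γ : GeodesicSegment X) (x : X) (t : ℝ) : Prop where
  mem : t ∈ Set.Icc (0 : ℝ) γ.len
  le : ∀ s ∈ Set.Icc (0 : ℝ) γ.len, dist x (γ.toFun t) ≤ dist x (γ.toFun s)

theorem exists_isProj (γ : GeodesicSegment X) (x : X) : ∃ t, IsProj γ x t := by
  have hc : ContinuousOn (fun t => dist x (γ.toFun t)) (Set.Icc 0 γ.len) :=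
    (continuous_const.dist continuous_id).comp_continuousOn γ.continuousOn_toFun
  obtain ⟨t, ht, h⟩ := isCompact_Icc.exists_isMinOn ⟨0, γ.zero_mem⟩ hc
  exact ⟨t, ht, fun s hs => h hs⟩

theorem mem_proj_iff {γ : GeodesicSegment X} {x p : X} :
    p ∈ proj γ x ↔ ∃ t, IsProj γ x t ∧ γ.toFun t = p := by
  have hne : γ.seg.Nonempty := ⟨_, 0, γ.zero_mem, rfl⟩
  constructor
  · rintro ⟨⟨t, ht, rfl⟩, h⟩
    exact ⟨t, ⟨ht, fun s hs => h ▸ Metric.infDist_le_dist_of_mem ⟨s, hs, rfl⟩⟩, rfl⟩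
  · rintro ⟨t, ht, rfl⟩
    refine ⟨⟨t, ht.mem, rfl⟩, le_antisymm ?_ (Metric.infDist_le_dist_of_mem ⟨t, ht.mem, rfl⟩)⟩
    refine (Metric.le_infDist hne).2 ?_
    rintro _ ⟨s, hs, rfl⟩
    exact ht.le s hs

theorem IsProj.reverse {γ : GeodesicSegment X} {x : X} {t : ℝ} (h : IsProj γ x t) :
    IsProj γ.reverse x (γ.len - t) := by
  refine ⟨⟨by linarith [h.mem.2], by
    show γ.len - t ≤ γ.len
    linarith [h.mem.1]⟩, fun s hs => ?_⟩
  have := h.le (γ.len - s) ⟨by linarith [show s ≤ γ.len from hs.2], by linarith [hs.1]⟩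
  simpa [GeodesicSegment.reverse] using this

theorem IsProj.of_reverse {γ : GeodesicSegment X} {x : X} {t : ℝ} (h : IsProj γ.reverse x t) :
    IsProj γ x (γ.len - t) := by
  have hm : t ∈ Set.Icc (0 : ℝ) γ.len := h.mem
  refine ⟨⟨by linarith [hm.2], by linarith [hm.1]⟩, fun s hs => ?_⟩
  have := h.le (γ.len - s) ⟨by linarith [hs.2], by
    show γ.len - s ≤ γ.len
    linarith [hs.1]⟩
  simpa [GeodesicSegment.reverse] using this

theorem IsProj.translate {γ : GeodesicSegment X} {x : X} {t : ℝ} (h : IsProj γ x t)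
    (f : X → X) (hf : Isometry f) : IsProj (γ.translate f hf) (f x) t :=
  ⟨h.mem, fun s hs => by
    simpa [GeodesicSegment.translate, hf.dist_eq] using h.le s hs⟩

theorem IsProj.of_translate {γ : GeodesicSegment X} {x : X} {t : ℝ} {f : X → X}
    {hf : Isometry f} (h : IsProj (γ.translate f hf) (f x) t) : IsProj γ x t :=
  ⟨h.mem, fun s hs => by
    simpa [GeodesicSegment.translate, hf.dist_eq] using h.le s hs⟩

section

variable {δ : ℝ}

theorem IsProj.le_dist (h4 : FourPoint X δ) (hδ : 0 < δ) {γ : GeodesicSegment X} {x : X}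
    {t : ℝ} (h : IsProj γ x t) {s : ℝ} (hs : s ∈ Set.Icc (0 : ℝ) γ.len) :
    dist x (γ.toFun t) + |s - t| - 13 * δ ≤ dist x (γ.toFun s) := by
  by_cases hst : |s - t| ≤ 13 * δ
  · linarith [h.le s hs]
  push Not at hst
  have ht := h.mem
  obtain ⟨r, hr, hrt, hsr⟩ : ∃ r ∈ Set.Icc (0 : ℝ) γ.len,
      |r - t| = 7 * δ ∧ |s - r| = |s - t| - 7 * δ := by
    rcases le_total t s with hle | hle
    · rw [abs_of_nonneg (by linarith)] at hst
      refine ⟨t + 7 * δ, ⟨by linarith [ht.1], by linarith [hs.2]⟩, ?_, ?_⟩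
      · rw [abs_of_nonneg (by linarith)]
        ring
      · rw [abs_of_nonneg (by linarith), abs_of_nonneg (by linarith)]
        ring
    · rw [abs_of_nonpos (by linarith)] at hst
      refine ⟨t - 7 * δ, ⟨by linarith [hs.1], by linarith [ht.2]⟩, ?_, ?_⟩
      · rw [abs_of_nonpos (by linarith)]
        ring
      · rw [abs_of_nonpos (by linarith), abs_of_nonpos (by linarith)]
        ring
  have h1 := h4 x (γ.toFun r) (γ.toFun t) (γ.toFun s)
  rw [γ.isom t ht s hs, γ.isom r hr s hs, γ.isom r hr t ht, hrt, abs_sub_comm r s, hsr,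
    abs_sub_comm t s] at h1
  have h2 := h.le r hr
  rcases max_cases (dist x (γ.toFun t) + (|s - t| - 7 * δ)) (dist x (γ.toFun s) + 7 * δ)
    with ⟨h3, -⟩ | ⟨h3, -⟩ <;> rw [h3] at h1 <;> linarith

theorem IsProj.abs_sub_le (h4 : FourPoint X δ) (hδ : 0 < δ) {γ : GeodesicSegment X} {x : X}
    {s t : ℝ} (ht : IsProj γ x t) (hs : IsProj γ x s) : |s - t| ≤ 13 * δ := by
  linarith [ht.le_dist h4 hδ hs.mem, hs.le t ht.mem]

theorem IsProj.le_dist_of_far (h4 : FourPoint X δ) (hδ : 0 < δ) {γ : GeodesicSegment X}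
    {x y : X} {a b : ℝ} (ha : IsProj γ x a) (hb : IsProj γ y b) (hab : 16 * δ < |a - b|) :
    dist x (γ.toFun a) + |a - b| + dist (γ.toFun b) y - 32 * δ ≤ dist x y := by
  have h1 := h4 x (γ.toFun b) (γ.toFun a) y
  have h2 := ha.le_dist h4 hδ hb.mem
  have h3 := hb.le_dist h4 hδ ha.mem
  rw [γ.isom b hb.mem a ha.mem] at h1
  rw [abs_sub_comm b a] at h1 h2
  rw [dist_comm y, dist_comm y] at h3
  rcases max_cases (dist x (γ.toFun a) + dist (γ.toFun b) y) (dist x y + |a - b|)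
    with ⟨h5, -⟩ | ⟨h5, -⟩ <;> rw [h5] at h1 <;> linarith

theorem IsProj.abs_sub_le_dist (h4 : FourPoint X δ) (hδ : 0 < δ) {γ : GeodesicSegment X}
    {x y : X} {a b : ℝ} (ha : IsProj γ x a) (hb : IsProj γ y b) :
    |a - b| ≤ dist x y + 32 * δ := by
  by_cases hab : 16 * δ < |a - b|
  · have := ha.le_dist_of_far h4 hδ hb hab
    linarith [dist_nonneg (x := x) (y := γ.toFun a), dist_nonneg (x := γ.toFun b) (y := y)]
  · linarith [dist_nonneg (x := x) (y := y)]

end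

/-! ### Alignment -/

/-- All closest point projections of `x` to `γ` are within `c` of the initial point. -/
def NearInitial (c : ℝ) (γ : GeodesicSegment X) (x : X) : Prop :=
  ∀ t, IsProj γ x t → t ≤ c

/-- All closest point projections of `x` to `γ` are within `c` of the terminal point. -/
def NearTerminal (c : ℝ) (γ : GeodesicSegment X) (x : X) : Prop :=
  ∀ t, IsProj γ x t → γ.len - c ≤ t

/-- `η` projects to `γ` near its terminal point, and `γ` to `η` near its initial point. -/
def PairNear (K : ℝ) (γ η : GeodesicSegment X) : Prop :=
  (∀ s ∈ Set.Icc (0 : ℝ) η.len, NearTerminal K γ (η.toFun s)) ∧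
  (∀ s ∈ Set.Icc (0 : ℝ) γ.len, NearInitial K η (γ.toFun s))

theorem NearInitial.reverse {c : ℝ} {γ : GeodesicSegment X} {x : X} (h : NearInitial c γ x) :
    NearTerminal c γ.reverse x := fun t ht => by
  have := h _ ht.of_reverse
  show γ.len - c ≤ t
  linarith

theorem NearTerminal.reverse {c : ℝ} {γ : GeodesicSegment X} {x : X} (h : NearTerminal c γ x) :
    NearInitial c γ.reverse x := fun t ht => by
  have := h _ ht.of_reverse
  linarith

theorem NearInitial.translate {c : ℝ} {γ : GeodesicSegment X} {x : X} (h : NearInitial c γ x)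
    (f : X → X) (hf : Isometry f) : NearInitial c (γ.translate f hf) (f x) :=
  fun t ht => h t ht.of_translate

theorem NearTerminal.translate {c : ℝ} {γ : GeodesicSegment X} {x : X}
    (h : NearTerminal c γ x) (f : X → X) (hf : Isometry f) :
    NearTerminal c (γ.translate f hf) (f x) :=
  fun t ht => h t ht.of_translate

theorem PairNear.reverse {K : ℝ} {γ η : GeodesicSegment X} (h : PairNear K γ η) :
    PairNear K η.reverse γ.reverse := by
  refine ⟨fun s hs => (h.2 (γ.len - s) ⟨?_, ?_⟩).reverse,
    fun s hs => (h.1 (η.len - s) ⟨?_, ?_⟩).reverse⟩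
  · linarith [show s ≤ γ.len from hs.2]
  · linarith [hs.1]
  · linarith [show s ≤ η.len from hs.2]
  · linarith [hs.1]

theorem PairNear.translate {K : ℝ} {γ η : GeodesicSegment X} (h : PairNear K γ η)
    (f : X → X) (hf : Isometry f) : PairNear K (γ.translate f hf) (η.translate f hf) :=
  ⟨fun s hs => (h.1 s hs).translate f hf, fun s hs => (h.2 s hs).translate f hf⟩

theorem isBounded_projSet_union (γ : GeodesicSegment X) (A : Set X) (p : X) :
    Bornology.IsBounded (projSet γ A ∪ {p}) := by
  refine (γ.isCompact_seg.isBounded.subset ?_).union Bornology.isBounded_singleton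
  exact Set.iUnion₂_subset fun a _ q hq => hq.1

theorem seg_point (p : X) : (GeodesicSegment.point p).seg = {p} := by
  simp [GeodesicSegment.seg, GeodesicSegment.point]

theorem AlignedPair.nearTerminal {K : ℝ} {γ η : GeodesicSegment X} (h : AlignedPair K γ η)
    {x : X} (hx : x ∈ η.seg) : NearTerminal K γ x := fun t ht => by
  have hmem : γ.toFun t ∈ projSet γ η.seg :=
    Set.mem_biUnion hx (mem_proj_iff.2 ⟨t, ht, rfl⟩)
  have := Metric.dist_le_diam_of_mem (isBounded_projSet_union γ η.seg γ.terminal)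
    (Or.inl hmem) (Or.inr rfl)
  rw [GeodesicSegment.terminal, γ.isom t ht.mem _ γ.len_mem] at this
  have h1 := h.1
  rw [GeodesicSegment.terminal] at h1
  linarith [neg_abs_le (t - γ.len)]

theorem AlignedPair.nearInitial {K : ℝ} {γ η : GeodesicSegment X} (h : AlignedPair K γ η)
    {x : X} (hx : x ∈ γ.seg) : NearInitial K η x := fun t ht => by
  have hmem : η.toFun t ∈ projSet η γ.seg :=
    Set.mem_biUnion hx (mem_proj_iff.2 ⟨t, ht, rfl⟩)
  have := Metric.dist_le_diam_of_mem (isBounded_projSet_union η γ.seg η.initial)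
    (Or.inl hmem) (Or.inr rfl)
  rw [GeodesicSegment.initial, η.isom t ht.mem _ η.zero_mem] at this
  have h1 := h.2
  rw [GeodesicSegment.initial] at h1
  linarith [le_abs_self (t - 0)]

theorem AlignedPair.pairNear {K : ℝ} {γ η : GeodesicSegment X} (h : AlignedPair K γ η) :
    PairNear K γ η :=
  ⟨fun s hs => h.nearTerminal ⟨s, hs, rfl⟩, fun s hs => h.nearInitial ⟨s, hs, rfl⟩⟩

theorem diam_projSet_point_union {K c δ : ℝ} (h4 : FourPoint X δ) (hδ : 0 < δ) (hc : c < K)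
    (hK : 13 * δ < K) {γ : GeodesicSegment X} {x p : X}
    (h : ∀ t, IsProj γ x t → dist (γ.toFun t) p ≤ c) :
    Metric.diam (projSet γ {x} ∪ {p}) < K := by
  refine lt_of_le_of_lt (Metric.diam_le_of_forall_dist_le (C := max c (13 * δ))
    (le_max_of_le_right (by positivity)) ?_) (max_lt hc hK)
  have key : ∀ q ∈ projSet γ {x}, ∃ t, IsProj γ x t ∧ γ.toFun t = q := fun q hq => by
    simpa [projSet, mem_proj_iff] using hq
  rintro y (hy | rfl) z (hz | rfl)
  · obtain ⟨s, hs, rfl⟩ := key y hy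
    obtain ⟨t, ht, rfl⟩ := key z hz
    rw [γ.isom s hs.mem t ht.mem]
    exact le_max_of_le_right (ht.abs_sub_le h4 hδ hs)
  · obtain ⟨s, hs, rfl⟩ := key y hy
    exact le_max_of_le_left (h s hs)
  · obtain ⟨s, hs, rfl⟩ := key z hz
    rw [dist_comm]
    exact le_max_of_le_left (h s hs)
  · rw [dist_self]
    exact le_max_of_le_right (by positivity)

theorem diam_projSet_point {K : ℝ} (hK : 0 < K) (x : X) (A : Set X) :
    Metric.diam (projSet (GeodesicSegment.point x) A ∪ {x}) < K := by
  rw [Metric.diam_subsingleton]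
  · exact hK
  · refine Set.subsingleton_of_subset_singleton (a := x) ?_
    refine Set.union_subset (Set.iUnion₂_subset fun a _ q hq => ?_) (subset_refl _)
    have := hq.1
    rwa [seg_point] at this

theorem NearInitial.alignedPair {K c δ : ℝ} (h4 : FourPoint X δ) (hδ : 0 < δ) (hc : c < K)
    (hK : 13 * δ < K) {γ : GeodesicSegment X} {x : X} (h : NearInitial c γ x) :
    AlignedPair K (GeodesicSegment.point x) γ := by
  refine ⟨diam_projSet_point (by linarith) x _, ?_⟩
  rw [seg_point]
  refine diam_projSet_point_union h4 hδ hc hK fun t ht => ?_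
  rw [GeodesicSegment.initial, γ.isom t ht.mem _ γ.zero_mem, sub_zero, abs_of_nonneg ht.mem.1]
  exact h t ht

theorem NearTerminal.alignedPair {K c δ : ℝ} (h4 : FourPoint X δ) (hδ : 0 < δ) (hc : c < K)
    (hK : 13 * δ < K) {γ : GeodesicSegment X} {x : X} (h : NearTerminal c γ x) :
    AlignedPair K γ (GeodesicSegment.point x) := by
  refine ⟨?_, diam_projSet_point (by linarith) x _⟩
  rw [seg_point]
  refine diam_projSet_point_union h4 hδ hc hK fun t ht => ?_
  rw [GeodesicSegment.terminal, γ.isom t ht.mem _ γ.len_mem, abs_of_nonpos (by linarith [ht.mem.2])]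
  linarith [h t ht]

theorem AlignedPair.mono {K K' : ℝ} (hK : K ≤ K') {γ η : GeodesicSegment X}
    (h : AlignedPair K γ η) : AlignedPair K' γ η :=
  ⟨h.1.trans_le hK, h.2.trans_le hK⟩

/-- A point projecting to `γ₁` away from its terminal point projects to `γ₂` near its
initial point, if `(γ₁, γ₂)` is aligned. -/
theorem PairNear.nearInitial {K δ : ℝ} (h4 : FourPoint X δ) (hδ : 0 < δ)
    {γ₁ γ₂ : GeodesicSegment X} (h : PairNear K γ₁ γ₂) {x : X} {a : ℝ} (ha : IsProj γ₁ x a)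
    (hlt : a < γ₁.len - (K + 45 * δ)) : NearInitial (K + 45 * δ) γ₂ x := by
  intro b hb
  obtain ⟨b', hb'⟩ := exists_isProj γ₁ (γ₂.toFun b)
  have h1 := h.1 b hb.mem b' hb'
  obtain ⟨p, hp⟩ := exists_isProj γ₂ (γ₁.toFun b')
  have h2 := h.2 b' hb'.mem p hp
  have h3 : |a - b'| = b' - a := by
    rw [abs_of_nonpos (by linarith)]
    ring
  have h5 := ha.le_dist_of_far h4 hδ hb' (by rw [h3]; linarith)
  have h6 := dist_triangle x (γ₁.toFun a) (γ₁.toFun b')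
  rw [γ₁.isom a ha.mem b' hb'.mem] at h6
  have h7 := hb.le p hp.mem
  have h8 := dist_triangle x (γ₁.toFun b') (γ₂.toFun p)
  have h9 := hp.le_dist h4 hδ hb.mem
  linarith [le_abs_self (b - p)]

/-- A family of `M` segments of length `ℓ`, consecutively aligned. -/
structure IsAlignedFamily (K ℓ : ℝ) (M : ℕ) (γ : ℕ → GeodesicSegment X) : Prop where
  len_eq : ∀ i < M, (γ i).len = ℓ
  pairNear : ∀ i, i + 1 < M → PairNear K (γ i) (γ (i + 1))

theorem IsAlignedFamily.nearInitial {K ℓ δ : ℝ} (h4 : FourPoint X δ) (hδ : 0 < δ) {M : ℕ}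
    {γ : ℕ → GeodesicSegment X} (h : IsAlignedFamily K ℓ M γ) (hℓ : 2 * (K + 45 * δ) < ℓ)
    {x : X} {i j : ℕ} (hij : i < j) (hj : j < M) {a : ℝ} (ha : IsProj (γ i) x a)
    (hlt : a < ℓ - (K + 45 * δ)) : NearInitial (K + 45 * δ) (γ j) x := by
  induction j, hij using Nat.le_induction with
  | base => exact (h.pairNear i hj).nearInitial h4 hδ ha (by rwa [h.len_eq i (by omega)])
  | succ j hij ih =>
    obtain ⟨b, hb⟩ := exists_isProj (γ j) x
    have := ih (by omega) b hb
    exact (h.pairNear j hj).nearInitial h4 hδ hb (by rw [h.len_eq j (by omega)]; linarith)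

theorem IsAlignedFamily.nearTerminal {K ℓ δ : ℝ} (h4 : FourPoint X δ) (hδ : 0 < δ) {M : ℕ}
    {γ : ℕ → GeodesicSegment X} (h : IsAlignedFamily K ℓ M γ) (hℓ : 2 * (K + 45 * δ) < ℓ)
    {x : X} {i j : ℕ} (hij : i < j) (hj : j < M) {b : ℝ} (hb : IsProj (γ j) x b)
    (hlt : K + 45 * δ < b) : NearTerminal (K + 45 * δ) (γ i) x := by
  intro a ha
  rw [h.len_eq i (by omega)]
  by_contra! hcon
  exact absurd (h.nearInitial h4 hδ hℓ hij hj ha hcon b hb) (not_le.2 hlt)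

/-! ### Discrete paths crossing an aligned family -/

theorem exists_crossing {f : ℕ → ℝ} {u v : ℕ} {c d : ℝ} (hcd : c < d) (huv : u ≤ v)
    (hu : f u ≤ c) (hv : d ≤ f v) :
    ∃ s t, u ≤ s ∧ s < t ∧ t ≤ v ∧ f s ≤ c ∧ d ≤ f t ∧
      ∀ j, s < j → j < t → c < f j ∧ f j < d := by
  classical
  have hex : ∃ t, u ≤ t ∧ d ≤ f t := ⟨v, huv, hv⟩
  obtain ⟨hut, hdt⟩ := Nat.find_spec hex
  have hmin : ∀ j, u ≤ j → j < Nat.find hex → f j < d := fun j hj hlt => by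
    by_contra! hcon
    exact Nat.find_min hex hlt ⟨hj, hcon⟩
  have hle : Nat.find hex ≤ v := Nat.find_min' hex ⟨huv, hv⟩
  set t := Nat.find hex
  have hs := Nat.findGreatest_spec (P := fun j => f j ≤ c) hut hu
  have hus := Nat.le_findGreatest (P := fun j => f j ≤ c) hut hu
  have hst := Nat.findGreatest_le (P := fun j => f j ≤ c) t
  have hgr : ∀ j, Nat.findGreatest (fun j => f j ≤ c) t < j → j ≤ t → ¬ f j ≤ c :=
    fun j h1 h2 => Nat.findGreatest_is_greatest h1 h2
  set s := Nat.findGreatest (fun j => f j ≤ c) t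
  have hne : s ≠ t := fun h => by
    rw [h] at hs
    linarith
  refine ⟨s, t, hus, by omega, hle, hs, hdt, fun j h1 h2 => ⟨?_, hmin j (by omega) h2⟩⟩
  exact not_le.1 (hgr j h1 h2.le)

open Classical in
/-- The times at which the path `x` projects to the middle part of `γ`. -/
noncomputable def visits (c : ℝ) (γ : GeodesicSegment X) (x : ℕ → X) (N : ℕ) : Finset ℕ :=
  (Finset.range (N + 1)).filter fun j => ∃ a, IsProj γ (x j) a ∧ c < a ∧ a < γ.len - c

theorem mem_visits {c : ℝ} {γ : GeodesicSegment X} {x : ℕ → X} {N j : ℕ} :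
    j ∈ visits c γ x N ↔ j ≤ N ∧ ∃ a, IsProj γ (x j) a ∧ c < a ∧ a < γ.len - c := by
  simp [visits]

theorem exists_visit_crossing {δ c Λ : ℝ} (h4 : FourPoint X δ) (hδ : 0 < δ) (hΛ : 0 ≤ Λ)
    {γ : GeodesicSegment X} (hlen : 2 * c + Λ + 32 * δ < γ.len) {x : ℕ → X} {N u v : ℕ}
    (huv : u ≤ v) (hvN : v ≤ N) (hstep : ∀ j < N, dist (x j) (x (j + 1)) ≤ Λ)
    (hu : NearInitial c γ (x u)) (hv : NearTerminal c γ (x v)) :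
    ∃ s t a b, u ≤ s ∧ s + 1 < t ∧ t ≤ v ∧ IsProj γ (x s) a ∧ IsProj γ (x t) b ∧
      γ.len - 2 * c ≤ b - a ∧ ∀ j, s < j → j < t → j ∈ visits c γ x N := by
  choose f hf using fun j => exists_isProj γ (x j)
  obtain ⟨s, t, hus, hst, htv, hs, ht, hmid⟩ :=
    exists_crossing (f := f) (c := c) (d := γ.len - c) (by linarith) huv (hu _ (hf u))
      (hv _ (hf v))
  refine ⟨s, t, f s, f t, hus, ?_, htv, hf s, hf t, by linarith, fun j h1 h2 =>
    mem_visits.2 ⟨by omega, f j, hf j, hmid j h1 h2⟩⟩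
  have h1 : f (s + 1) < γ.len - c := by
    have := (hf s).abs_sub_le_dist h4 hδ (hf (s + 1))
    linarith [hstep s (by omega), neg_abs_le (f s - f (s + 1))]
  rcases Nat.lt_or_ge (s + 1) t with h | h
  · exact h
  · have : t = s + 1 := by omega
    rw [this] at ht
    linarith

theorem IsAlignedFamily.disjoint_visits {K ℓ δ : ℝ} (h4 : FourPoint X δ) (hδ : 0 < δ) {M : ℕ}
    {γ : ℕ → GeodesicSegment X} (h : IsAlignedFamily K ℓ M γ) (hℓ : 2 * (K + 45 * δ) < ℓ)
    (x : ℕ → X) (N : ℕ) {i j : ℕ} (hij : i ≠ j) (hi : i < M) (hj : j < M) :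
    Disjoint (visits (K + 45 * δ) (γ i) x N) (visits (K + 45 * δ) (γ j) x N) := by
  wlog hlt : i < j generalizing i j
  · exact (this hij.symm hj hi (by omega)).symm
  rw [Finset.disjoint_left]
  intro k hk hk'
  obtain ⟨-, a, ha, -, ha2⟩ := mem_visits.1 hk
  obtain ⟨-, b, hb, hb1, -⟩ := mem_visits.1 hk'
  rw [h.len_eq i hi] at ha2
  exact absurd (h.nearInitial h4 hδ hℓ hlt hj ha ha2 b hb) (not_le.2 hb1)

/-- A path of step at most `Λ` crossing all members of a family of segments. -/
structure IsCrossingPath (c Λ : ℝ) (M : ℕ) (γ : ℕ → GeodesicSegment X) (x : ℕ → X)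
    (N : ℕ) : Prop where
  step : ∀ j < N, dist (x j) (x (j + 1)) ≤ Λ
  start : ∀ i < M, NearInitial c (γ i) (x 0)
  finish : ∀ i < M, NearTerminal c (γ i) (x N)

theorem IsCrossingPath.le_of_mem_visits {K ℓ δ Λ : ℝ} (h4 : FourPoint X δ) (hδ : 0 < δ)
    (hΛ : 0 ≤ Λ) {M : ℕ} {γ : ℕ → GeodesicSegment X}
    (h : IsAlignedFamily K ℓ M γ)
    (hℓ : 2 * (K + 45 * δ) + Λ + 32 * δ < ℓ) {x : ℕ → X} {N : ℕ}
    (hx : IsCrossingPath (K + 45 * δ) Λ M γ x N) {i k : ℕ} (hi : i < M)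
    (hk : k ∈ visits (K + 45 * δ) (γ i) x N) : i ≤ k ∧ M + k ≤ N + 1 + i := by
  have hℓ' : 2 * (K + 45 * δ) < ℓ := by linarith
  obtain ⟨hkN, a, ha, ha1, ha2⟩ := mem_visits.1 hk
  rw [h.len_eq i hi] at ha2
  have hdis : ∀ j₁ < M, ∀ j₂ < M, ∀ r, r ∈ visits (K + 45 * δ) (γ j₁) x N →
      r ∈ visits (K + 45 * δ) (γ j₂) x N → j₁ = j₂ := fun j₁ h₁ j₂ h₂ r hr₁ hr₂ => by
    by_contra hne
    exact Finset.disjoint_left.1 (h.disjoint_visits h4 hδ hℓ' x N hne h₁ h₂) hr₁ hr₂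
  constructor
  · have hbefore : ∀ j, ∃ r, j < i → r < k ∧ r ∈ visits (K + 45 * δ) (γ j) x N := fun j => by
      by_cases hj : j < i
      · obtain ⟨s, t, -, -, -, hst, htk, -, -, -, hvis⟩ := exists_visit_crossing h4 hδ hΛ
          (by rwa [h.len_eq j (by omega)]) (Nat.zero_le k) hkN hx.step (hx.start j (by omega))
          (h.nearTerminal h4 hδ hℓ' hj hi ha ha1)
        exact ⟨s + 1, fun _ => ⟨by omega, hvis _ (by omega) hst⟩⟩
      · exact ⟨0, fun h => absurd h hj⟩
    choose r hr using hbefore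
    have := Finset.card_le_card_of_injOn (s := Finset.range i) (t := Finset.range k) r
      (fun j hj => by
        have := (hr j (by simpa using hj)).1
        simpa using this)
      (fun j₁ h₁ j₂ h₂ he => by
        have h₁ : j₁ < i := by simpa using h₁
        have h₂ : j₂ < i := by simpa using h₂
        exact hdis j₁ (by omega) j₂ (by omega) (r j₁) (hr j₁ h₁).2 (he ▸ (hr j₂ h₂).2))
    simpa using this
  · have hafter : ∀ j, ∃ r, i < j ∧ j < M → k < r ∧ r ≤ N ∧
        r ∈ visits (K + 45 * δ) (γ j) x N := fun j => by
      by_cases hj : i < j ∧ j < M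
      · obtain ⟨s, t, -, -, hks, hst, htN, -, -, -, hvis⟩ := exists_visit_crossing h4 hδ hΛ
          (by rwa [h.len_eq j (by omega)]) hkN le_rfl hx.step
          (h.nearInitial h4 hδ hℓ' hj.1 hj.2 ha ha2) (hx.finish j hj.2)
        exact ⟨s + 1, fun _ => ⟨by omega, by omega, hvis _ (by omega) hst⟩⟩
      · exact ⟨0, fun h => absurd h hj⟩
    choose r hr using hafter
    have := Finset.card_le_card_of_injOn (s := Finset.Ioo i M) (t := Finset.Ioc k N) r
      (fun j hj => by
        have := hr j (by simpa using hj)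
        simpa using ⟨this.1, this.2.1⟩)
      (fun j₁ h₁ j₂ h₂ he => by
        have h₁ : i < j₁ ∧ j₁ < M := by simpa using h₁
        have h₂ : i < j₂ ∧ j₂ < M := by simpa using h₂
        exact hdis j₁ h₁.2 j₂ h₂.2 (r j₁) (hr j₁ h₁).2.2 (he ▸ (hr j₂ h₂).2.2))
    simp only [Nat.card_Ioo, Nat.card_Ioc] at this
    omega

theorem IsAlignedFamily.sum_card_visits_le {K ℓ δ : ℝ} (h4 : FourPoint X δ) (hδ : 0 < δ)
    {M : ℕ} {γ : ℕ → GeodesicSegment X} (h : IsAlignedFamily K ℓ M γ)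
    (hℓ : 2 * (K + 45 * δ) < ℓ) (x : ℕ → X) (N : ℕ) {s : Finset ℕ} (hs : ∀ i ∈ s, i < M) :
    ∑ i ∈ s, (visits (K + 45 * δ) (γ i) x N).card ≤ N + 1 := by
  rw [← Finset.card_biUnion fun i hi j hj hij =>
    h.disjoint_visits h4 hδ hℓ x N hij (hs i hi) (hs j hj)]
  refine (Finset.card_le_card (t := Finset.range (N + 1)) ?_).trans (by simp)
  intro k hk
  obtain ⟨i, -, hi⟩ := Finset.mem_biUnion.1 hk
  simpa [Nat.lt_succ_iff] using (mem_visits.1 hi).1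

/-- Some middle index of the family is crossed quickly by both of two given paths. -/
theorem IsAlignedFamily.exists_card_visits_le {K ℓ δ : ℝ} (h4 : FourPoint X δ) (hδ : 0 < δ)
    {M : ℕ} {γ : ℕ → GeodesicSegment X} (h : IsAlignedFamily K ℓ M γ)
    (hℓ : 2 * (K + 45 * δ) < ℓ) (x y : ℕ → X) (N : ℕ) {q D : ℕ} (hq : 3 * q ≤ M)
    (hD : 2 * (N + 1) < q * (D + 1)) :
    ∃ i, q ≤ i ∧ i < 2 * q ∧ (visits (K + 45 * δ) (γ i) x N).card ≤ D ∧
      (visits (K + 45 * δ) (γ i) y N).card ≤ D := by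
  have hs : ∀ i ∈ Finset.Ico q (2 * q), i < M := fun i hi => by
    have := Finset.mem_Ico.1 hi
    omega
  have hx := h.sum_card_visits_le h4 hδ hℓ x N hs
  have hy := h.sum_card_visits_le h4 hδ hℓ y N hs
  by_contra! hcon
  have hsum : ∑ _i ∈ Finset.Ico q (2 * q), (D + 1) ≤ ∑ i ∈ Finset.Ico q (2 * q),
      ((visits (K + 45 * δ) (γ i) x N).card + (visits (K + 45 * δ) (γ i) y N).card) := by
    refine Finset.sum_le_sum fun i hi => ?_
    obtain ⟨h1, h2⟩ := Finset.mem_Ico.1 hi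
    by_cases hle : (visits (K + 45 * δ) (γ i) x N).card ≤ D
    · have := hcon i h1 h2 hle
      omega
    · omega
  rw [Finset.sum_const, Finset.sum_add_distrib, Nat.card_Ico, smul_eq_mul,
    show 2 * q - q = q by omega] at hsum
  omega

/-! ### Word length and growth -/

section WordLength

variable {S : Finset G}

theorem exists_word (hS : Subgroup.closure (S : Set G) = ⊤) (g : G) :
    ∃ l : List G, l.length = wordLength S g ∧ (∀ x ∈ l, x ∈ S ∨ x⁻¹ ∈ S) ∧ l.prod = g := by
  have hne : {n | ∃ l : List G, l.length = n ∧ (∀ x ∈ l, x ∈ S ∨ x⁻¹ ∈ S) ∧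
      l.prod = g}.Nonempty := by
    have hg : g ∈ (Subgroup.closure (S : Set G)).toSubmonoid := by
      rw [hS]
      trivial
    rw [Subgroup.closure_toSubmonoid] at hg
    obtain ⟨l, hl, hg⟩ := Submonoid.exists_list_of_mem_closure hg
    exact ⟨l.length, l, rfl, by simpa using hl, hg⟩
  exact Nat.sInf_mem hne

theorem wordLength_prod_le {l : List G} (hl : ∀ x ∈ l, x ∈ S ∨ x⁻¹ ∈ S) :
    wordLength S l.prod ≤ l.length :=
  Nat.sInf_le ⟨l, rfl, hl, rfl⟩

theorem wordLength_one : wordLength S (1 : G) = 0 :=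
  Nat.le_zero.1 (wordLength_prod_le (S := S) (l := ([] : List G)) (by simp))

theorem wordLength_le_one {s : G} (hs : s ∈ S ∨ s = 1) : wordLength S s ≤ 1 := by
  rcases hs with hs | rfl
  · simpa using wordLength_prod_le (S := S) (l := [s]) (by simp [hs])
  · simp [wordLength_one]

theorem wordLength_mul_le (hS : Subgroup.closure (S : Set G) = ⊤) (g h : G) :
    wordLength S (g * h) ≤ wordLength S g + wordLength S h := by
  obtain ⟨l, hl, hlS, rfl⟩ := exists_word hS g
  obtain ⟨l', hl', hlS', rfl⟩ := exists_word hS h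
  rw [← hl, ← hl', ← List.prod_append, ← List.length_append]
  refine wordLength_prod_le fun x hx => ?_
  rcases List.mem_append.1 hx with hx | hx
  · exact hlS x hx
  · exact hlS' x hx

theorem wordLength_inv_le (hS : Subgroup.closure (S : Set G) = ⊤) (g : G) :
    wordLength S g⁻¹ ≤ wordLength S g := by
  obtain ⟨l, hl, hlS, rfl⟩ := exists_word hS g
  rw [← hl, List.prod_inv_reverse]
  refine (wordLength_prod_le fun x hx => ?_).trans (by simp)
  obtain ⟨y, hy, rfl⟩ : ∃ y ∈ l, y⁻¹ = x := by simpa using hx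
  simpa using (hlS y hy).symm

theorem wordLength_inv (hS : Subgroup.closure (S : Set G) = ⊤) (g : G) :
    wordLength S g⁻¹ = wordLength S g :=
  le_antisymm (wordLength_inv_le hS g) (by simpa using wordLength_inv_le hS g⁻¹)

theorem wordLength_pow_le (hS : Subgroup.closure (S : Set G) = ⊤) (g : G) (n : ℕ) :
    wordLength S (g ^ n) ≤ n * wordLength S g := by
  induction n with
  | zero => simp [wordLength_one]
  | succ n ih =>
    rw [pow_succ]
    refine (wordLength_mul_le hS _ _).trans ?_
    linarith

theorem exists_geodesic_word_path (hS : Subgroup.closure (S : Set G) = ⊤) (g : G) :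
    ∃ v : ℕ → G, v 0 = 1 ∧ v (wordLength S g) = g ∧
      ∀ i j, i ≤ j → wordLength S ((v i)⁻¹ * v j) ≤ j - i := by
  obtain ⟨l, hl, hlS, rfl⟩ := exists_word hS g
  refine ⟨fun j => (l.take j).prod, by simp, by simp [← hl], fun i j hij => ?_⟩
  have h : (l.take j).prod = (l.take i).prod * ((l.take j).drop i).prod := by
    rw [← List.prod_append]
    congr 1
    conv_lhs => rw [← List.take_append_drop i (l.take j), List.take_take, min_eq_left hij]
  show wordLength S ((l.take i).prod⁻¹ * (l.take j).prod) ≤ j - i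
  rw [h, inv_mul_cancel_left]
  refine (wordLength_prod_le fun x hx => hlS x ?_).trans ?_
  · exact List.mem_of_mem_take (List.mem_of_mem_drop hx)
  · simp only [List.length_drop, List.length_take]
    omega

/-- The ball of integer radius `n` in the word metric. -/
def wordBall (S : Finset G) (n : ℕ) : Set G := {g | wordLength S g ≤ n}

theorem ball_natCast (n : ℕ) : ball S (n : ℝ) = wordBall S n := by
  ext g
  simp [ball, wordBall]

theorem wordBall_mono {m n : ℕ} (h : m ≤ n) : wordBall S m ⊆ wordBall S n :=
  fun _ hg => le_trans hg h

theorem finite_wordBall (hS : Subgroup.closure (S : Set G) = ⊤) (n : ℕ) :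
    (wordBall S n).Finite := by
  induction n with
  | zero =>
    refine (Set.finite_singleton (1 : G)).subset fun g hg => ?_
    obtain ⟨l, hl, -, rfl⟩ := exists_word hS g
    have : l = [] := List.length_eq_zero_iff.1 (hl.trans (Nat.le_zero.1 hg))
    simp [this]
  | succ n ih =>
    have hT : {x : G | x ∈ S ∨ x⁻¹ ∈ S}.Finite := by
      refine Set.Finite.union S.finite_toSet ?_
      exact S.finite_toSet.preimage inv_injective.injOn
    refine (ih.union (hT.image2 (· * ·) ih)).subset fun g hg => ?_
    obtain ⟨l, hl, hlS, rfl⟩ := exists_word hS g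
    have hle : l.length ≤ n + 1 := hl.trans_le hg
    cases l with
    | nil => exact Or.inl (by simp [wordBall, wordLength_one])
    | cons x l =>
      refine Or.inr ⟨x, hlS x (by simp), l.prod, ?_, by simp⟩
      refine (wordLength_prod_le fun y hy => hlS y (by simp [hy])).trans ?_
      simpa using hle

theorem one_le_ncard_wordBall (hS : Subgroup.closure (S : Set G) = ⊤) (n : ℕ) :
    1 ≤ (wordBall S n).ncard := by
  exact (Set.ncard_pos (finite_wordBall hS n)).2 ⟨1, by simp [wordBall, wordLength_one]⟩

theorem le_ncard_image_quotient (hS : Subgroup.closure (S : Set G) = ⊤) (H : Subgroup G)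
    (hH : ¬ H.FiniteIndex) (m : ℕ) :
    m + 1 ≤ ((fun g : G => (g : G ⧸ H)) '' wordBall S m).ncard := by
  induction m with
  | zero =>
    exact (Set.ncard_pos ((finite_wordBall hS 0).image _)).2 ⟨_, 1, by simp [wordBall, wordLength_one], rfl⟩
  | succ m ih =>
    have hsub : (fun g : G => (g : G ⧸ H)) '' wordBall S m ⊆
        (fun g : G => (g : G ⧸ H)) '' wordBall S (m + 1) :=
      Set.image_mono (wordBall_mono (Nat.le_succ m))
    refine Nat.succ_le_of_lt (lt_of_le_of_lt ih (Set.ncard_lt_ncard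
      (hsub.ssubset_of_ne fun heq => hH ?_) ((finite_wordBall hS _).image _)))
    have hstep : ∀ x, x ∈ S ∨ x⁻¹ ∈ S → ∀ g : G,
        (g : G ⧸ H) ∈ (fun g : G => (g : G ⧸ H)) '' wordBall S m →
        ((x * g : G) : G ⧸ H) ∈ (fun g : G => (g : G ⧸ H)) '' wordBall S m := by
      rintro x hx g ⟨b, hb, hbg⟩
      rw [heq]
      refine ⟨x * b, (wordLength_mul_le hS x b).trans ?_, ?_⟩
      · have : wordLength S x ≤ 1 := by
          rcases hx with hx | hx
          · exact wordLength_le_one (Or.inl hx)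
          · rw [← wordLength_inv hS]
            exact wordLength_le_one (Or.inl hx)
        have hb' : wordLength S b ≤ m := hb
        omega
      · have h1 : b⁻¹ * g ∈ H := QuotientGroup.eq.1 hbg
        refine QuotientGroup.eq.2 ?_
        simpa [mul_assoc] using h1
    have hall : ∀ l : List G, (∀ x ∈ l, x ∈ S ∨ x⁻¹ ∈ S) →
        ((l.prod : G) : G ⧸ H) ∈ (fun g : G => (g : G ⧸ H)) '' wordBall S m := by
      intro l
      induction l with
      | nil => exact fun _ => ⟨1, by simp [wordBall, wordLength_one], by simp⟩
      | cons x l ihl =>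
        intro hl
        rw [List.prod_cons]
        exact hstep x (hl x (by simp)) _ (ihl fun y hy => hl y (by simp [hy]))
    have huniv : (Set.univ : Set (G ⧸ H)).Finite := by
      refine ((finite_wordBall hS m).image (fun g : G => (g : G ⧸ H))).subset fun c _ => ?_
      obtain ⟨g, rfl⟩ := QuotientGroup.mk_surjective c
      obtain ⟨l, -, hl, rfl⟩ := exists_word hS g
      exact hall l hl
    have : Finite (G ⧸ H) := Set.finite_univ_iff.1 huniv
    exact Subgroup.finiteIndex_of_finite_quotient

/-- The growth of a group that is not virtually cyclic and contains an element of infinite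
order is at least quadratic. -/
theorem sq_le_ncard_wordBall (hS : Subgroup.closure (S : Set G) = ⊤)
    (hNVC : NonVirtuallyCyclic G) {φ : G} (hφ : Function.Injective fun n : ℕ => φ ^ n) (m : ℕ) :
    (m + 1) * (m + 1) ≤ (wordBall S (m + m * wordLength S φ)).ncard := by
  set H := Subgroup.zpowers φ
  have hH : ¬ H.FiniteIndex := fun h => hNVC ⟨H, h, Subgroup.isCyclic_zpowers φ⟩
  set Q := (fun g : G => (g : G ⧸ H)) '' wordBall S m with hQ
  have hQfin : Q.Finite := (finite_wordBall hS m).image _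
  have hrep : ∀ c : G ⧸ H, ∃ g : G, c ∈ Q → g ∈ wordBall S m ∧ (g : G ⧸ H) = c := fun c => by
    by_cases hc : c ∈ Q
    · obtain ⟨g, hg, hgc⟩ := hc
      exact ⟨g, fun _ => ⟨hg, hgc⟩⟩
    · exact ⟨1, fun h => absurd h hc⟩
  choose r hr using hrep
  have hcard : (m + 1) * (m + 1) ≤ (Q ×ˢ (Finset.range (m + 1) : Set ℕ)).ncard := by
    rw [Set.ncard_prod, Set.ncard_coe_finset, Finset.card_range]
    exact Nat.mul_le_mul_right _ (le_ncard_image_quotient hS H hH m)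
  refine hcard.trans (Set.ncard_le_ncard_of_injOn (fun p => r p.1 * φ ^ p.2) ?_ ?_
    (finite_wordBall hS _))
  · rintro ⟨c, j⟩ ⟨hc, hj⟩
    have h1 : wordLength S (r c) ≤ m := (hr c hc).1
    have h2 : j ≤ m := Nat.lt_succ_iff.1 (by simpa using hj)
    have h3 := wordLength_pow_le hS φ j
    have h4 := Nat.mul_le_mul_right (wordLength S φ) h2
    show wordLength S (r c * φ ^ j) ≤ _
    exact (wordLength_mul_le hS (r c) (φ ^ j)).trans (by omega)
  · rintro ⟨c, j⟩ ⟨hc, -⟩ ⟨c', j'⟩ ⟨hc', -⟩ heq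
    have heq : r c * φ ^ j = r c' * φ ^ j' := heq
    have hcc : c = c' := by
      rw [← (hr c hc).2, ← (hr c' hc').2]
      refine QuotientGroup.eq.2 ?_
      have : (r c)⁻¹ * r c' = φ ^ j * (φ ^ j')⁻¹ := by
        rw [eq_mul_inv_iff_mul_eq, mul_assoc, ← heq, inv_mul_cancel_left]
      rw [this]
      exact H.mul_mem (H.pow_mem (Subgroup.mem_zpowers φ) _)
        (H.inv_mem (H.pow_mem (Subgroup.mem_zpowers φ) _))
    subst hcc
    simp only [Prod.mk.injEq, true_and]
    exact hφ (mul_left_cancel heq)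

end WordLength

/-! ### Translates of a rigid segment crossed by a pair of points -/

section Fellow

variable {δ : ℝ} {x y : X}

theorem IsProj.dist_le_of_between (h4 : FourPoint X δ) (hδ : 0 < δ) {γ : GeodesicSegment X}
    {a b t : ℝ} (ha : IsProj γ x a) (hb : IsProj γ y b) (hab : 16 * δ < b - a) (hat : a ≤ t)
    (htb : t ≤ b) :
    dist x (γ.toFun t) ≤ dist x (γ.toFun a) + (t - a) ∧
      dist (γ.toFun t) y ≤ dist x y - dist x (γ.toFun a) - (t - a) + 32 * δ := by
  have ht : t ∈ Set.Icc (0 : ℝ) γ.len := ⟨ha.mem.1.trans hat, htb.trans hb.mem.2⟩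
  have h1 := ha.le_dist_of_far h4 hδ hb (by rw [abs_of_nonpos (by linarith)]; linarith)
  have h2 := dist_triangle x (γ.toFun a) (γ.toFun t)
  have h3 := dist_triangle (γ.toFun t) (γ.toFun b) y
  rw [γ.isom _ ha.mem _ ht] at h2
  rw [γ.isom _ ht _ hb.mem] at h3
  rw [abs_of_nonpos (by linarith)] at h1 h2 h3
  constructor <;> linarith

theorem dist_le_of_nearly_between (h4 : FourPoint X δ) {u v : X} {r s : ℝ} (hrs : |r - s| ≤ δ)
    (hxu : dist x u ≤ r) (huy : dist u y ≤ dist x y - r + 32 * δ)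
    (hxv : dist x v ≤ s) (hvy : dist v y ≤ dist x y - s + 32 * δ) : dist u v ≤ 39 * δ := by
  have h1 := h4 x y u v
  rw [dist_comm y u, dist_comm y v] at h1
  have h2 := abs_le.1 hrs
  rcases max_cases (dist x u + dist v y) (dist x v + dist u y) with ⟨h3, -⟩ | ⟨h3, -⟩ <;>
    rw [h3] at h1 <;> linarith

/-- Two segments of which large parts are crossed at comparable distance from `x` by the same
pair of points have large projections to each other. -/
theorem IsProj.le_sub_of_crossings (h4 : FourPoint X δ) (hδ : 0 < δ) {γ γ' : GeodesicSegment X}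
    {a b a' b' T p q : ℝ} (hT : 52 * δ < T)
    (ha : IsProj γ x a) (hb : IsProj γ y b) (hab : T ≤ b - a)
    (ha' : IsProj γ' x a') (hb' : IsProj γ' y b') (hab' : T ≤ b' - a')
    (hd : |dist x (γ.toFun a) - dist x (γ'.toFun a')| ≤ δ)
    (hp : IsProj γ γ'.initial p) (hq : IsProj γ γ'.terminal q) : T - 92 * δ ≤ q - p := by
  have h1 := ha.dist_le_of_between h4 hδ hb (by linarith) le_rfl (by linarith)
  have h2 := ha.dist_le_of_between (t := a + T) h4 hδ hb (by linarith) (by linarith) (by linarith)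
  have h1' := ha'.dist_le_of_between h4 hδ hb' (by linarith) le_rfl (by linarith)
  have h2' := ha'.dist_le_of_between (t := a' + T) h4 hδ hb' (by linarith) (by linarith)
    (by linarith)
  have hu : dist (γ.toFun a) (γ'.toFun a') ≤ 39 * δ :=
    dist_le_of_nearly_between (x := x) (y := y) h4 hd le_rfl (by linarith [h1.2]) le_rfl
      (by linarith [h1'.2])
  have hv : dist (γ.toFun (a + T)) (γ'.toFun (a' + T)) ≤ 39 * δ :=
    dist_le_of_nearly_between (x := x) (y := y) (r := dist x (γ.toFun a) + T)
      (s := dist x (γ'.toFun a') + T) h4 (by simpa using hd) (by linarith [h2.1])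
      (by linarith [h2.2]) (by linarith [h2'.1]) (by linarith [h2'.2])
  have haT : a + T ∈ Set.Icc (0 : ℝ) γ.len :=
    ⟨by linarith [ha.mem.1], by linarith [hb.mem.2]⟩
  have haT' : a' + T ∈ Set.Icc (0 : ℝ) γ'.len :=
    ⟨by linarith [ha'.mem.1], by linarith [hb'.mem.2]⟩
  have key : ∀ (o : X) (s t r : ℝ), s ∈ Set.Icc (0 : ℝ) γ.len → t ∈ Set.Icc (0 : ℝ) γ.len →
      IsProj γ o r → dist o (γ.toFun s) + T - 78 * δ ≤ dist o (γ.toFun t) →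
      |s - r| + T - 91 * δ ≤ |t - r| := by
    intro o s t r hs ht hr h
    have h3 := hr.le_dist h4 hδ hs
    have h5 := dist_triangle o (γ.toFun r) (γ.toFun t)
    rw [γ.isom _ hr.mem _ ht, abs_sub_comm r t] at h5
    linarith
  have hp' : p ≤ a + 46 * δ := by
    have h3 := key γ'.initial a (a + T) p ha.mem haT hp (by
      have e1 := dist_triangle γ'.initial (γ'.toFun a') (γ.toFun a)
      have e2 := dist_triangle γ'.initial (γ.toFun (a + T)) (γ'.toFun (a' + T))
      unfold GeodesicSegment.initial at e1 e2 ⊢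
      rw [γ'.isom _ γ'.zero_mem _ ha'.mem, dist_comm (γ'.toFun a'),
        abs_of_nonpos (by linarith [ha'.mem.1])] at e1
      rw [γ'.isom _ γ'.zero_mem _ haT', abs_of_nonpos (by linarith [haT'.1])] at e2
      linarith)
    by_contra hlt
    push Not at hlt
    rw [abs_of_nonpos (by linarith)] at h3
    rcases abs_cases (a + T - p) with ⟨h5, -⟩ | ⟨h5, -⟩ <;> rw [h5] at h3 <;> linarith
  have hq' : a + T - 46 * δ ≤ q := by
    have h3 := key γ'.terminal (a + T) a q haT ha.mem hq (by
      have e1 := dist_triangle γ'.terminal (γ'.toFun (a' + T)) (γ.toFun (a + T))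
      have e2 := dist_triangle γ'.terminal (γ.toFun a) (γ'.toFun a')
      unfold GeodesicSegment.terminal at e1 e2 ⊢
      rw [γ'.isom _ γ'.len_mem _ haT', dist_comm (γ'.toFun (a' + T)),
        abs_of_nonneg (by linarith [haT'.2])] at e1
      rw [γ'.isom _ γ'.len_mem _ ha'.mem, abs_of_nonneg (by linarith [ha'.mem.2])] at e2
      linarith)
    by_contra hlt
    push Not at hlt
    rw [abs_of_nonneg (by linarith)] at h3
    rcases abs_cases (a - q) with ⟨h5, -⟩ | ⟨h5, -⟩ <;> rw [h5] at h3 <;> linarith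
  linarith

end Fellow

/-- `ρ` is an action by isometries. -/
structure IsIsometricAction (ρ : G → X → X) : Prop where
  isometry : ∀ g, Isometry (ρ g)
  mul : ∀ g h x, ρ (g * h) x = ρ g (ρ h x)
  one : ∀ x, ρ 1 x = x

section Action

variable {ρ : G → X → X} {S : Finset G} {x₀ : X}

theorem IsIsometricAction.dist_eq (hρ : IsIsometricAction ρ) (g h : G) (x y : X) :
    dist (ρ g x) (ρ h y) = dist x (ρ (g⁻¹ * h) y) := by
  rw [← (hρ.isometry g).dist_eq x, ← hρ.mul, mul_inv_cancel_left]

theorem IsIsometricAction.dist_le_mul_wordLength (hρ : IsIsometricAction ρ)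
    (hS : Subgroup.closure (S : Set G) = ⊤) {Λ : ℝ}
    (hΛ : ∀ s ∈ S, dist x₀ (ρ s x₀) ≤ Λ) (g : G) :
    dist x₀ (ρ g x₀) ≤ Λ * wordLength S g := by
  obtain ⟨l, hl, hlS, rfl⟩ := exists_word hS g
  rw [← hl]
  clear hl
  induction l with
  | nil => simp [hρ.one]
  | cons s l ih =>
    have h1 := dist_triangle x₀ (ρ s x₀) (ρ (s * l.prod) x₀)
    rw [hρ.dist_eq s, inv_mul_cancel_left] at h1
    have h2 : dist x₀ (ρ s x₀) ≤ Λ := by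
      rcases hlS s (by simp) with hs | hs
      · exact hΛ s hs
      · rw [dist_comm, ← hρ.one x₀, ← hρ.mul, mul_one, hρ.dist_eq, mul_one]
        simpa [hρ.one] using hΛ _ hs
    have h3 := ih fun z hz => hlS z (by simp [hz])
    rw [List.prod_cons, List.length_cons, Nat.cast_succ]
    linarith

/-- The translate of `γ` by `h`. -/
def IsIsometricAction.translate (hρ : IsIsometricAction ρ) (γ : GeodesicSegment X) (h : G) :
    GeodesicSegment X :=
  γ.translate (ρ h) (hρ.isometry h)

theorem IsIsometricAction.isProj_translate_iff (hρ : IsIsometricAction ρ)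
    {γ : GeodesicSegment X} {g h : G} {x : X} {t : ℝ} :
    IsProj (hρ.translate γ (g * h)) (ρ g x) t ↔ IsProj (hρ.translate γ h) x t := by
  have h1 : ∀ s, dist (ρ g x) ((hρ.translate γ (g * h)).toFun s) =
      dist x ((hρ.translate γ h).toFun s) := fun s => by
    show dist (ρ g x) (ρ (g * h) (γ.toFun s)) = dist x (ρ h (γ.toFun s))
    rw [hρ.dist_eq, inv_mul_cancel_left]
  constructor
  · exact fun h => ⟨h.mem, fun s hs => by rw [← h1, ← h1]; exact h.le s hs⟩
  · exact fun h => ⟨h.mem, fun s hs => by rw [h1, h1]; exact h.le s hs⟩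

/-- Only translates by elements of word length at most `R` have projection to `γ` longer
than `E`. -/
def IsRigid (S : Finset G) (ρ : G → X → X) (γ : GeodesicSegment X) (E : ℝ) (R : ℕ) : Prop :=
  ∀ g p q, IsProj γ (ρ g γ.initial) p → IsProj γ (ρ g γ.terminal) q → E < q - p →
    wordLength S g ≤ R

theorem IsRigid.reverse {γ : GeodesicSegment X} {E : ℝ} {R : ℕ} (h : IsRigid S ρ γ E R) :
    IsRigid S ρ γ.reverse E R := by
  intro g p q hp hq hpq
  have h1 : γ.reverse.initial = γ.terminal := by
    simp [GeodesicSegment.reverse, GeodesicSegment.initial, GeodesicSegment.terminal]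
  have h2 : γ.reverse.terminal = γ.initial := by
    simp [GeodesicSegment.reverse, GeodesicSegment.initial, GeodesicSegment.terminal]
  rw [h1] at hp
  rw [h2] at hq
  exact h g _ _ hq.of_reverse hp.of_reverse (by linarith)

theorem E0Spec.isRigid {φ : G} {E0 : ℝ} (h : E0Spec S ρ x₀ φ E0) (hρ : IsIsometricAction ρ)
    (hS : Subgroup.closure (S : Set G) = ⊤) {L : ℕ} (hL : 0 < L) {γ : GeodesicSegment X}
    (h0 : γ.initial = x₀) (h1 : γ.terminal = ρ (φ ^ L) x₀) :
    IsRigid S ρ γ E0 (⌈E0⌉₊ + 2 * (L * wordLength S φ)) := by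
  intro g p q hp hq hpq
  rw [h0] at hp
  rw [h1, ← hρ.mul] at hq
  have hE := h.1
  obtain ⟨i, j, hi, hj, hij⟩ := h.2.2 L hL g γ h0 h1 _ (mem_proj_iff.2 ⟨p, hp, rfl⟩) _
    (mem_proj_iff.2 ⟨q, hq, rfl⟩) ⟨p, q, hp.mem, hq.mem, by linarith, rfl, rfl⟩
    (by rw [γ.isom _ hp.mem _ hq.mem, abs_of_nonpos (by linarith)]; linarith)
  have h2 : wordDist S (φ ^ i) (g * φ ^ j) ≤ ⌈E0⌉₊ := by
    have := hij.le.trans (Nat.le_ceil E0)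
    exact_mod_cast this
  have h3 : g = φ ^ i * ((φ ^ i)⁻¹ * (g * φ ^ j)) * (φ ^ j)⁻¹ := by group
  have h4 := wordLength_mul_le hS (φ ^ i * ((φ ^ i)⁻¹ * (g * φ ^ j))) (φ ^ j)⁻¹
  have h5 := wordLength_mul_le hS (φ ^ i) ((φ ^ i)⁻¹ * (g * φ ^ j))
  rw [← h3, wordLength_inv hS] at h4
  have h6 := (wordLength_pow_le hS φ i).trans (Nat.mul_le_mul_right _ hi)
  have h7 := (wordLength_pow_le hS φ j).trans (Nat.mul_le_mul_right _ hj)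
  unfold wordDist at h2
  omega

/-- The elements `h` such that a part of length `T` of `h γ`, at distance at most `r` from `x`,
is crossed when going from `x` to `y`. -/
def IsIsometricAction.crossings (hρ : IsIsometricAction ρ) (γ : GeodesicSegment X)
    (T r : ℝ) (x y : X) : Set G :=
  {h | ∃ a b, IsProj (hρ.translate γ h) x a ∧ IsProj (hρ.translate γ h) y b ∧
    T ≤ b - a ∧ dist x ((hρ.translate γ h).toFun a) ≤ r}

theorem IsIsometricAction.wordLength_le_of_crossings (hρ : IsIsometricAction ρ) {δ : ℝ}
    (h4 : FourPoint X δ) (hδ : 0 < δ) {γ : GeodesicSegment X} {E T : ℝ} {R : ℕ}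
    (hγ : IsRigid S ρ γ E R) (hT : 52 * δ < T) (hET : E + 92 * δ < T) {x y : X} {h h' : G}
    {a b a' b' : ℝ} (ha : IsProj (hρ.translate γ h) x a) (hb : IsProj (hρ.translate γ h) y b)
    (hab : T ≤ b - a) (ha' : IsProj (hρ.translate γ h') x a')
    (hb' : IsProj (hρ.translate γ h') y b') (hab' : T ≤ b' - a')
    (hd : |dist x ((hρ.translate γ h).toFun a) - dist x ((hρ.translate γ h').toFun a')| ≤ δ) :
    wordLength S (h⁻¹ * h') ≤ R := by
  obtain ⟨p, hp⟩ := exists_isProj (hρ.translate γ h) (hρ.translate γ h').initial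
  obtain ⟨q, hq⟩ := exists_isProj (hρ.translate γ h) (hρ.translate γ h').terminal
  have hpq := ha.le_sub_of_crossings h4 hδ hT hb hab ha' hb' hab' hd hp hq
  refine hγ (h⁻¹ * h') p q ?_ ?_ (by linarith)
  · refine IsProj.of_translate (f := ρ h) (hf := hρ.isometry h) ?_
    rw [← hρ.mul, mul_inv_cancel_left]
    exact hp
  · refine IsProj.of_translate (f := ρ h) (hf := hρ.isometry h) ?_
    rw [← hρ.mul, mul_inv_cancel_left]
    exact hq

theorem IsIsometricAction.finite_crossings (hρ : IsIsometricAction ρ)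
    (hS : Subgroup.closure (S : Set G) = ⊤) {δ : ℝ}
    (h4 : FourPoint X δ) (hδ : 0 < δ) {γ : GeodesicSegment X} {E T : ℝ} {R : ℕ}
    (hγ : IsRigid S ρ γ E R) (hT : 52 * δ < T) (hET : E + 92 * δ < T) (r : ℝ) (x y : X) :
    (hρ.crossings γ T r x y).Finite ∧
      (hρ.crossings γ T r x y).ncard ≤ (⌊r / δ⌋₊ + 1) * (wordBall S R).ncard := by
  set fib : ℕ → Set G := fun k => {h | ∃ a b, IsProj (hρ.translate γ h) x a ∧
    IsProj (hρ.translate γ h) y b ∧ T ≤ b - a ∧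
    ⌊dist x ((hρ.translate γ h).toFun a) / δ⌋₊ = k} with hfib
  have hsub : hρ.crossings γ T r x y ⊆ ⋃ k ∈ Finset.range (⌊r / δ⌋₊ + 1), fib k := by
    rintro h ⟨a, b, ha, hb, hab, hr⟩
    refine Set.mem_biUnion (x := ⌊dist x ((hρ.translate γ h).toFun a) / δ⌋₊) ?_
      ⟨a, b, ha, hb, hab, rfl⟩
    simp only [Finset.coe_range, Set.mem_Iio, Order.lt_add_one_iff]
    gcongr
  have hfin : ∀ k, ∃ g : G, fib k ⊆ (g * ·) '' wordBall S R := by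
    intro k
    rcases (fib k).eq_empty_or_nonempty with h0 | ⟨h, a, b, ha, hb, hab, hk⟩
    · exact ⟨1, by simp [h0]⟩
    · refine ⟨h, fun h' hh' => ?_⟩
      obtain ⟨a', b', ha', hb', hab', hk'⟩ := hh'
      refine ⟨h⁻¹ * h', ?_, mul_inv_cancel_left h h'⟩
      refine hρ.wordLength_le_of_crossings h4 hδ hγ hT hET ha hb hab ha' hb' hab' ?_
      have e1 := Nat.floor_le (div_nonneg (dist_nonneg (x := x)
        (y := (hρ.translate γ h).toFun a)) hδ.le)
      have e2 := Nat.lt_floor_add_one (dist x ((hρ.translate γ h).toFun a) / δ)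
      have e3 := Nat.floor_le (div_nonneg (dist_nonneg (x := x)
        (y := (hρ.translate γ h').toFun a')) hδ.le)
      have e4 := Nat.lt_floor_add_one (dist x ((hρ.translate γ h').toFun a') / δ)
      rw [hk] at e1 e2
      rw [hk'] at e3 e4
      rw [le_div_iff₀ hδ] at e1 e3
      rw [div_lt_iff₀ hδ] at e2 e4
      rw [abs_le]
      constructor <;> linarith
  choose g hg using hfin
  have hfin : ∀ k, (fib k).Finite := fun k => ((finite_wordBall hS R).image _).subset (hg k)
  have hU : (⋃ k ∈ Finset.range (⌊r / δ⌋₊ + 1), fib k).Finite :=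
    Set.Finite.biUnion (Finset.finite_toSet _) fun k _ => hfin k
  refine ⟨hU.subset hsub, (Set.ncard_le_ncard hsub hU).trans ?_⟩
  refine (Finset.set_ncard_biUnion_le _ _).trans ?_
  refine (Finset.sum_le_card_nsmul _ _ (wordBall S R).ncard fun k _ => ?_).trans (by simp)
  exact (Set.ncard_le_ncard (hg k) ((finite_wordBall hS R).image _)).trans
    (Set.ncard_image_le (finite_wordBall hS R))

/-- Translates of a rigid segment that are crossed by short elements are close to the identity. -/
theorem IsIsometricAction.exists_wordLength_le (hρ : IsIsometricAction ρ)
    (hS : Subgroup.closure (S : Set G) = ⊤) {δ : ℝ}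
    (h4 : FourPoint X δ) (hδ : 0 < δ) {γ : GeodesicSegment X} {E T : ℝ} {R : ℕ}
    (hγ : IsRigid S ρ γ E R) (hT : 52 * δ < T) (hET : E + 92 * δ < T) (x₀ : X) (D : ℕ) :
    ∃ R' : ℕ, ∀ u v h : G, wordLength S (u⁻¹ * v) ≤ D → ∀ a b,
      IsProj (hρ.translate γ h) (ρ u x₀) a → IsProj (hρ.translate γ h) (ρ v x₀) b →
      T ≤ b - a → wordLength S (u⁻¹ * h) ≤ R' := by
  have hfin : (⋃ w ∈ wordBall S D, hρ.crossings γ T (dist x₀ (ρ w x₀) + 32 * δ) x₀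
      (ρ w x₀)).Finite :=
    (finite_wordBall hS D).biUnion fun w _ => (hρ.finite_crossings hS h4 hδ hγ hT hET _ _ _).1
  obtain ⟨R', hR'⟩ := (hfin.image (wordLength S)).bddAbove
  refine ⟨R', fun u v h huv a b ha hb hab => hR' ⟨_, Set.mem_biUnion huv ?_, rfl⟩⟩
  have ha' : IsProj (hρ.translate γ (u⁻¹ * h)) x₀ a := by
    rw [← hρ.isProj_translate_iff (g := u), mul_inv_cancel_left]
    exact ha
  have hb' : IsProj (hρ.translate γ (u⁻¹ * h)) (ρ (u⁻¹ * v) x₀) b := by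
    rw [← hρ.isProj_translate_iff (g := u), mul_inv_cancel_left, ← hρ.mul, mul_inv_cancel_left]
    exact hb
  refine ⟨a, b, ha', hb', hab, ?_⟩
  have h1 := ha'.le_dist_of_far h4 hδ hb' (by rw [abs_of_nonpos (by linarith)]; linarith)
  linarith [abs_nonneg (a - b), dist_nonneg (x := (hρ.translate γ (u⁻¹ * h)).toFun b)
    (y := ρ (u⁻¹ * v) x₀)]

end Action

/-! ### Supermultiplicativity of growth -/

section Growth

variable {ρ : G → X → X} {S : Finset G} {x₀ : X}

theorem IsLoxodromic.tendsto_dist {φ : G} (h : IsLoxodromic ρ x₀ φ) :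
    Filter.Tendsto (fun n : ℕ => dist x₀ (ρ (φ ^ n) x₀)) Filter.atTop Filter.atTop := by
  obtain ⟨τ, hτ, hlim⟩ := h
  refine (hlim.pos_mul_atTop hτ tendsto_natCast_atTop_atTop).congr' ?_
  filter_upwards [Filter.eventually_gt_atTop 0] with n hn
  have : (n : ℝ) ≠ 0 := by positivity
  field_simp

theorem IsLoxodromic.injective_pow {φ : G} (h : IsLoxodromic ρ x₀ φ)
    (hone : ∀ x, ρ 1 x = x) : Function.Injective fun n : ℕ => φ ^ n := by
  rw [injective_pow_iff_not_isOfFinOrder, isOfFinOrder_iff_pow_eq_one]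
  rintro ⟨d, hd, hφ⟩
  obtain ⟨N, hN⟩ := Filter.eventually_atTop.1 (h.tendsto_dist.eventually_gt_atTop 0)
  have := hN (d * N) (Nat.le_mul_of_pos_left N hd)
  rw [pow_mul, hφ, one_pow, hone, dist_self] at this
  exact lt_irrefl _ this

theorem IsProj.le_of_gromovProd_le {δ E : ℝ} (h4 : FourPoint X δ) (hδ : 0 < δ)
    {γ : GeodesicSegment X} {y : X} {p : ℝ} (hp : IsProj γ y p)
    (hE : gromovProd γ.initial γ.terminal y ≤ E) : p ≤ E + 7 * δ := by
  have h1 := hp.le_dist h4 hδ γ.zero_mem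
  have h2 := dist_triangle y (γ.toFun p) (γ.toFun γ.len)
  rw [γ.isom _ hp.mem _ γ.len_mem, abs_of_nonpos (by linarith [hp.mem.2])] at h2
  rw [abs_of_nonpos (by linarith [hp.mem.1])] at h1
  unfold gromovProd at hE
  rw [dist_comm γ.terminal γ.initial, γ.dist_initial_terminal, dist_comm _ y,
    dist_comm _ y] at hE
  unfold GeodesicSegment.initial GeodesicSegment.terminal at hE
  linarith

theorem IsIsometricAction.ncard_mul_ncard_le (hρ : IsIsometricAction ρ)
    (hS : Subgroup.closure (S : Set G) = ⊤) {δ : ℝ} (h4 : FourPoint X δ) (hδ : 0 < δ)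
    {φ : G} {E0 : ℝ} (hE0 : E0Spec S ρ x₀ φ E0) {Λ : ℝ} (hΛ0 : 0 ≤ Λ)
    (hΛ : ∀ s ∈ S, dist x₀ (ρ s x₀) ≤ Λ) {L : ℕ} (hL : 0 < L)
    {γ : GeodesicSegment X} (h0 : γ.initial = x₀) (h1 : γ.terminal = ρ (φ ^ L) x₀)
    (hlen : 3 * E0 + 110 * δ < γ.len) :
    ∃ A c : ℕ, 0 < A ∧ ∀ k l : ℕ, (wordBall S k).ncard * (wordBall S l).ncard ≤
      A * (k + 1) * (wordBall S (k + l + c)).ncard := by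
  classical
  have hE := hE0.1
  have hrig := hE0.isRigid hρ hS hL h0 h1
  set R := ⌈E0⌉₊ + 2 * (L * wordLength S φ)
  choose s t hs ht hs' ht' using hE0.2.1
  set S' : Finset G := insert 1 S with hS'
  have hmem : ∀ z, (z ∈ S ∨ z = 1) → z ∈ S' := fun z hz => by
    rw [hS', Finset.mem_insert]
    exact hz.symm
  refine ⟨(⌈Λ / δ⌉₊ + 1) * (wordBall S R).ncard * (S'.card * S'.card),
    2 + L * wordLength S φ, ?_, fun k l => ?_⟩
  · have h2 := one_le_ncard_wordBall hS R
    have h3 : 0 < S'.card := Finset.card_pos.2 ⟨1, by simp [hS']⟩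
    positivity
  set F : G × G → G := fun z => z.1 * (s z.1⁻¹)⁻¹ * φ ^ L * t z.2 * z.2 with hF
  have hcross : ∀ g h, wordLength S g ≤ k → g * (s g⁻¹)⁻¹ ∈
      hρ.crossings γ (γ.len - 2 * E0 - 14 * δ) (Λ * (k + 1)) x₀ (ρ (F (g, h)) x₀) := by
    intro g h hg
    obtain ⟨p, hp⟩ := exists_isProj γ (ρ (s g⁻¹ * g⁻¹) x₀)
    obtain ⟨q, hq⟩ := exists_isProj γ (ρ (φ ^ L * t h * h) x₀)
    have hp' := hp.le_of_gromovProd_le h4 hδ (E := E0) (by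
      rw [h0, h1]
      simpa using hs' g⁻¹ L (by exact_mod_cast hL))
    have hq' := hq.reverse.le_of_gromovProd_le h4 hδ (E := E0) (by
      have h2 : γ.reverse.initial = γ.terminal := by
        simp [GeodesicSegment.reverse, GeodesicSegment.initial, GeodesicSegment.terminal]
      have h3 : γ.reverse.terminal = γ.initial := by
        simp [GeodesicSegment.reverse, GeodesicSegment.initial, GeodesicSegment.terminal]
      rw [h2, h3, h0, h1]
      have h5 := ht' h (-L) (by simpa using hL)
      unfold gromovProd at h5 ⊢
      have e1 : dist x₀ (ρ (φ ^ L) x₀) = dist (ρ (φ ^ (-(L : ℤ))) x₀) x₀ := by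
        conv_rhs => rw [← hρ.one x₀]
        rw [← hρ.mul, hρ.dist_eq]
        simp
      have e2 : dist (ρ (φ ^ L) x₀) (ρ (φ ^ L * t h * h) x₀) = dist x₀ (ρ (t h * h) x₀) := by
        rw [hρ.dist_eq, mul_assoc, inv_mul_cancel_left]
      have e3 : dist x₀ (ρ (φ ^ L * t h * h) x₀) =
          dist (ρ (φ ^ (-(L : ℤ))) x₀) (ρ (t h * h) x₀) := by
        rw [hρ.dist_eq]
        simp [mul_assoc]
      rw [e1, e2, e3]
      exact h5)
    refine ⟨p, q, ?_, ?_, by linarith, ?_⟩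
    · have := hp.translate (ρ (g * (s g⁻¹)⁻¹)) (hρ.isometry _)
      rw [← hρ.mul] at this
      have e : g * (s g⁻¹)⁻¹ * (s g⁻¹ * g⁻¹) = 1 := by group
      rw [e, hρ.one] at this
      exact this
    · have := hq.translate (ρ (g * (s g⁻¹)⁻¹)) (hρ.isometry _)
      rw [← hρ.mul] at this
      have e : g * (s g⁻¹)⁻¹ * (φ ^ L * t h * h) = F (g, h) := by simp only [hF]; group
      rw [e] at this
      exact this
    · have h2 := (hp.translate (ρ (g * (s g⁻¹)⁻¹)) (hρ.isometry _)).le 0 γ.zero_mem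
      rw [← hρ.mul] at h2
      have e : g * (s g⁻¹)⁻¹ * (s g⁻¹ * g⁻¹) = 1 := by group
      rw [e, hρ.one] at h2
      refine h2.trans ?_
      show dist x₀ (ρ (g * (s g⁻¹)⁻¹) γ.initial) ≤ _
      rw [h0]
      refine (hρ.dist_le_mul_wordLength hS hΛ _).trans ?_
      have h3 := wordLength_mul_le hS g (s g⁻¹)⁻¹
      rw [wordLength_inv hS] at h3
      have h5 := wordLength_le_one (hs g⁻¹)
      have h6 : wordLength S (g * (s g⁻¹)⁻¹) ≤ k + 1 := by omega
      gcongr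
      exact_mod_cast h6
  have hfin := fun f => hρ.finite_crossings hS h4 hδ hrig
    (T := γ.len - 2 * E0 - 14 * δ) (by linarith) (by linarith) (Λ * (k + 1)) x₀ (ρ f x₀)
  have hBk := finite_wordBall hS k
  have hBl := finite_wordBall hS l
  have hBn := finite_wordBall hS (k + l + (2 + L * wordLength S φ))
  rw [Set.ncard_eq_toFinset_card _ hBk, Set.ncard_eq_toFinset_card _ hBl,
    Set.ncard_eq_toFinset_card _ hBn, ← Finset.card_product]
  refine Finset.card_le_mul_card_image_of_maps_to (f := F) ?_ _ ?_
  · rintro ⟨g, h⟩ hgh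
    simp only [Finset.mem_product, Set.Finite.mem_toFinset] at hgh ⊢
    have hg : wordLength S g ≤ k := hgh.1
    have hh : wordLength S h ≤ l := hgh.2
    show wordLength S (g * (s g⁻¹)⁻¹ * φ ^ L * t h * h) ≤ _
    have e1 := wordLength_mul_le hS (g * (s g⁻¹)⁻¹ * φ ^ L * t h) h
    have e2 := wordLength_mul_le hS (g * (s g⁻¹)⁻¹ * φ ^ L) (t h)
    have e3 := wordLength_mul_le hS (g * (s g⁻¹)⁻¹) (φ ^ L)
    have e4 := wordLength_mul_le hS g (s g⁻¹)⁻¹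
    rw [wordLength_inv hS] at e4
    have e5 := wordLength_le_one (hs g⁻¹)
    have e6 := wordLength_le_one (ht h)
    have e7 := wordLength_pow_le hS φ L
    omega
  · intro f _
    have hle : (hfin f).1.toFinset.card ≤ (⌈Λ / δ⌉₊ + 1) * (wordBall S R).ncard * (k + 1) := by
      rw [← Set.ncard_eq_toFinset_card _ (hfin f).1]
      refine (hfin f).2.trans ?_
      have h2 : ⌊Λ * (k + 1) / δ⌋₊ ≤ ⌈Λ / δ⌉₊ * (k + 1) := by
        refine Nat.floor_le_of_le ?_
        push_cast
        rw [mul_div_right_comm]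
        gcongr
        exact Nat.le_ceil _
      calc (⌊Λ * (k + 1) / δ⌋₊ + 1) * (wordBall S R).ncard
          ≤ (⌈Λ / δ⌉₊ * (k + 1) + (k + 1)) * (wordBall S R).ncard := by
            gcongr
            omega
        _ = _ := by ring
    have hcard : ((hfin f).1.toFinset ×ˢ (S' ×ˢ S')).card ≤
        (⌈Λ / δ⌉₊ + 1) * (wordBall S R).ncard * (S'.card * S'.card) * (k + 1) := by
      rw [Finset.card_product, Finset.card_product]
      calc _ ≤ (⌈Λ / δ⌉₊ + 1) * (wordBall S R).ncard * (k + 1) * (S'.card * S'.card) := by gcongr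
        _ = _ := by ring
    refine (Finset.card_le_card_of_injOn
      (fun z => (z.1 * (s z.1⁻¹)⁻¹, s z.1⁻¹, t z.2)) ?_ ?_).trans hcard
    · rintro ⟨g, h⟩ hgh
      simp only [Finset.coe_filter, Finset.mem_product, Set.Finite.mem_toFinset,
        Set.mem_ofPred_eq] at hgh
      simp only [Finset.coe_product, Set.mem_prod, Finset.mem_coe, Set.Finite.mem_toFinset]
      refine ⟨?_, hmem _ (hs _), hmem _ (ht _)⟩
      rw [← hgh.2]
      exact hcross g h hgh.1.1
    · rintro ⟨g, h⟩ hgh ⟨g', h'⟩ hgh' heq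
      simp only [Finset.coe_filter, Set.mem_ofPred_eq] at hgh hgh'
      simp only [Prod.mk.injEq] at heq
      obtain ⟨e1, e2, e3⟩ := heq
      have e4 : g = g' := by
        rw [e2] at e1
        exact mul_right_cancel e1
      subst e4
      have e5 := hgh.2.trans hgh'.2.symm
      simp only [hF, e3] at e5
      rw [mul_left_cancel e5]

theorem two_mul_ncard_wordBall_le (hS : Subgroup.closure (S : Set G) = ⊤)
    (hNVC : NonVirtuallyCyclic G) {φ : G} (hφ : Function.Injective fun n : ℕ => φ ^ n)
    {A c : ℕ} (hA : 0 < A) (h : ∀ k l : ℕ, (wordBall S k).ncard * (wordBall S l).ncard ≤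
      A * (k + 1) * (wordBall S (k + l + c)).ncard) :
    ∃ k₀, 0 < k₀ ∧ ∀ q l, 2 ^ q * (wordBall S l).ncard ≤ (wordBall S (l + q * k₀)).ncard := by
  set m := 2 * A * (1 + wordLength S φ) with hm
  set k := m + m * wordLength S φ with hk
  have hmpos : 0 < m := by positivity
  have hbig : 2 * A * (k + 1) ≤ (wordBall S k).ncard := by
    refine le_trans ?_ (sq_le_ncard_wordBall hS hNVC hφ m)
    have h1 : k + 1 ≤ (1 + wordLength S φ) * (m + 1) := by
      rw [hk]
      nlinarith
    calc 2 * A * (k + 1) ≤ 2 * A * ((1 + wordLength S φ) * (m + 1)) := by gcongr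
      _ = m * (m + 1) := by rw [hm]; ring
      _ ≤ _ := by gcongr; omega
  have hstep : ∀ l, 2 * (wordBall S l).ncard ≤ (wordBall S (l + (k + c))).ncard := by
    intro l
    have h1 := h k l
    have h2 := Nat.mul_le_mul_right (wordBall S l).ncard hbig
    have e : k + l + c = l + (k + c) := by ring
    rw [e] at h1
    have h3 : 0 < A * (k + 1) := by positivity
    refine Nat.le_of_mul_le_mul_left ?_ h3
    calc _ = 2 * A * (k + 1) * (wordBall S l).ncard := by ring
      _ ≤ _ := h2.trans h1
  refine ⟨k + c, by omega, fun q l => ?_⟩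
  induction q with
  | zero => simp
  | succ q ih =>
    have h1 := hstep (l + q * (k + c))
    have e : l + (q + 1) * (k + c) = l + q * (k + c) + (k + c) := by ring
    rw [e, pow_succ]
    linarith

end Growth

/-! ### Elements that are short up to conjugation and bounded error -/

section Bad

variable {ρ : G → X → X} {S : Finset G} {x₀ : X}

/-- Elements of the form `y z u y⁻¹` or `y u (y z)⁻¹`, where `u` has length at most `R` and
the total length of `y` and `z` is at most `n - q`. -/
def badSet (S : Finset G) (R q n : ℕ) : Set G :=
  {g | ∃ y z u : G, wordLength S u ≤ R ∧ wordLength S y + wordLength S z + q ≤ n ∧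
    (g = y * z * u * y⁻¹ ∨ g = y * u * (y * z)⁻¹)}

theorem inv_mem_badSet (hS : Subgroup.closure (S : Set G) = ⊤) {R q n : ℕ} {g : G}
    (hg : g⁻¹ ∈ badSet S R q n) : g ∈ badSet S R q n := by
  obtain ⟨y, z, u, hu, hyz, h⟩ := hg
  refine ⟨y, z, u⁻¹, by rwa [wordLength_inv hS], hyz, ?_⟩
  rw [inv_eq_iff_eq_inv, inv_eq_iff_eq_inv] at h
  rcases h with h | h
  · right
    rw [h]
    group
  · left
    rw [h]
    group

theorem badSet_mono {R R' q n : ℕ} (h : R ≤ R') : badSet S R q n ⊆ badSet S R' q n := by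
  rintro g ⟨y, z, u, hu, hyz, hg⟩
  exact ⟨y, z, u, hu.trans h, hyz, hg⟩

theorem finite_badSet_and_ncard_le (hS : Subgroup.closure (S : Set G) = ⊤) {A c : ℕ}
    (h : ∀ k l : ℕ, (wordBall S k).ncard * (wordBall S l).ncard ≤
      A * (k + 1) * (wordBall S (k + l + c)).ncard) (R : ℕ) {q n : ℕ} (hq : q ≤ n) :
    (badSet S R q n).Finite ∧ (badSet S R q n).ncard ≤
      2 * (wordBall S R).ncard * A * ((n + 1) * (n + 1)) * (wordBall S (n - q + c)).ncard := by
  set B : ℕ → Set (G × G × G) :=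
    fun i => wordBall S i ×ˢ wordBall S (n - q - i) ×ˢ wordBall S R with hB
  have hBfin : ∀ i, (B i).Finite := fun i =>
    (finite_wordBall hS _).prod ((finite_wordBall hS _).prod (finite_wordBall hS _))
  set f₁ : G × G × G → G := fun p => p.1 * p.2.1 * p.2.2 * p.1⁻¹
  set f₂ : G × G × G → G := fun p => p.1 * p.2.2 * (p.1 * p.2.1)⁻¹
  have hsub : badSet S R q n ⊆
      ⋃ i ∈ Finset.range (n - q + 1), (f₁ '' B i ∪ f₂ '' B i) := by
    rintro g ⟨y, z, u, hu, hyz, hg⟩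
    have hmem : (y, z, u) ∈ B (wordLength S y) :=
      ⟨le_refl (wordLength S y), show wordLength S z ≤ _ by omega, hu⟩
    refine Set.mem_biUnion (x := wordLength S y) ?_ ?_
    · simp only [Finset.coe_range, Set.mem_Iio]
      omega
    · rcases hg with rfl | rfl
      · exact Or.inl ⟨_, hmem, rfl⟩
      · exact Or.inr ⟨_, hmem, rfl⟩
  have hfin : (⋃ i ∈ Finset.range (n - q + 1), (f₁ '' B i ∪ f₂ '' B i)).Finite :=
    (Finset.finite_toSet _).biUnion fun i _ => ((hBfin i).image _).union ((hBfin i).image _)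
  refine ⟨hfin.subset hsub, (Set.ncard_le_ncard hsub hfin).trans
    ((Finset.set_ncard_biUnion_le _ _).trans ?_)⟩
  have hterm : ∀ i ∈ Finset.range (n - q + 1), (f₁ '' B i ∪ f₂ '' B i).ncard ≤
      2 * (wordBall S R).ncard * A * (n + 1) * (wordBall S (n - q + c)).ncard := by
    intro i hi
    have hi' : i ≤ n - q := by simpa [Nat.lt_succ_iff] using hi
    have h1 := Set.ncard_image_le (f := f₁) (hBfin i)
    have h2 := Set.ncard_image_le (f := f₂) (hBfin i)
    have h3 : (B i).ncard =
        (wordBall S i).ncard * ((wordBall S (n - q - i)).ncard * (wordBall S R).ncard) := by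
      rw [hB, Set.ncard_prod, Set.ncard_prod]
    have h5 := h i (n - q - i)
    have e : i + (n - q - i) + c = n - q + c := by omega
    rw [e] at h5
    calc (f₁ '' B i ∪ f₂ '' B i).ncard ≤ 2 * (B i).ncard :=
          (Set.ncard_union_le _ _).trans (by omega)
      _ = 2 * (wordBall S R).ncard *
          ((wordBall S i).ncard * (wordBall S (n - q - i)).ncard) := by rw [h3]; ring
      _ ≤ 2 * (wordBall S R).ncard * (A * (i + 1) * (wordBall S (n - q + c)).ncard) := by gcongr
      _ ≤ 2 * (wordBall S R).ncard * (A * (n + 1) * (wordBall S (n - q + c)).ncard) := by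
          gcongr
          omega
      _ = _ := by ring
  refine (Finset.sum_le_card_nsmul _ _ _ hterm).trans ?_
  rw [Finset.card_range, smul_eq_mul]
  calc _ ≤ (n + 1) *
        (2 * (wordBall S R).ncard * A * (n + 1) * (wordBall S (n - q + c)).ncard) := by
        gcongr
        omega
    _ = _ := by ring

theorem IsIsometricAction.exists_wordLength_visit_le (hρ : IsIsometricAction ρ)
    (hS : Subgroup.closure (S : Set G) = ⊤) {δ Λ c : ℝ} (h4 : FourPoint X δ) (hδ : 0 < δ)
    (hΛ : 0 ≤ Λ) {γ : GeodesicSegment X} (hlen : 2 * c + Λ + 32 * δ < γ.len) {D R : ℕ}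
    (hR : ∀ u v h : G, wordLength S (u⁻¹ * v) ≤ D + 1 → ∀ a b,
      IsProj (hρ.translate γ h) (ρ u x₀) a → IsProj (hρ.translate γ h) (ρ v x₀) b →
      γ.len - 2 * c ≤ b - a → wordLength S (u⁻¹ * h) ≤ R)
    {v : ℕ → G} (hv : ∀ i j, i ≤ j → wordLength S ((v i)⁻¹ * v j) ≤ j - i) {M N : ℕ}
    {h : ℕ → G} (hx : IsCrossingPath c Λ M (fun i => hρ.translate γ (h i))
      (fun j => ρ (v j) x₀) N) {i : ℕ} (hi : i < M)
    (hD : (visits c (hρ.translate γ (h i)) (fun j => ρ (v j) x₀) N).card ≤ D) :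
    ∃ k ∈ visits c (hρ.translate γ (h i)) (fun j => ρ (v j) x₀) N,
      wordLength S ((v k)⁻¹ * h i) ≤ R + 1 := by
  obtain ⟨s, t, a, b, -, hst, -, ha, hb, hab, hvis⟩ := exists_visit_crossing h4 hδ hΛ
    (γ := hρ.translate γ (h i)) hlen (Nat.zero_le N) le_rfl hx.step (hx.start i hi)
    (hx.finish i hi)
  have hcard : t - s - 1 ≤ D := by
    refine le_trans ?_ hD
    have : Finset.Ioo s t ⊆ visits c (hρ.translate γ (h i)) (fun j => ρ (v j) x₀) N :=
      fun j hj => hvis j (Finset.mem_Ioo.1 hj).1 (Finset.mem_Ioo.1 hj).2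
    simpa using Finset.card_le_card this
  have h1 := hR (v s) (v t) (h i) ((hv s t (by omega)).trans (by omega)) a b ha hb hab
  refine ⟨s + 1, hvis _ (by omega) hst, ?_⟩
  have h2 := wordLength_mul_le hS ((v s)⁻¹ * v (s + 1))⁻¹ ((v s)⁻¹ * h i)
  rw [wordLength_inv hS] at h2
  have h3 := hv s (s + 1) (by omega)
  have e : ((v s)⁻¹ * v (s + 1))⁻¹ * ((v s)⁻¹ * h i) = (v (s + 1))⁻¹ * h i := by group
  rw [e] at h2
  omega

/-- If a long aligned family of translates lies both on the way from `x₀` to `g x₀` and on the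
way from `x₀` to `g⁻¹ x₀`, then `g` is short up to conjugation and bounded error. -/
theorem IsIsometricAction.exists_mem_badSet (hρ : IsIsometricAction ρ)
    (hS : Subgroup.closure (S : Set G) = ⊤) {δ Λ K E : ℝ} {R : ℕ} (h4 : FourPoint X δ)
    (hδ : 0 < δ) (hΛ0 : 0 ≤ Λ) (hΛ : ∀ s ∈ S, dist x₀ (ρ s x₀) ≤ Λ) {γ : GeodesicSegment X}
    (hγ : IsRigid S ρ γ E R) (hE : 0 ≤ E) (hlen : 2 * (K + 45 * δ) + Λ + E + 92 * δ < γ.len)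
    (D : ℕ) :
    ∃ R' : ℕ, ∀ (g : G) (n q M : ℕ) (h : ℕ → G), wordLength S g ≤ n → 3 * q ≤ M →
      2 * (n + 1) < q * (D + 1) →
      IsAlignedFamily K γ.len M (fun i => hρ.translate γ (h i)) →
      (∀ i < M, NearInitial (K + 45 * δ) (hρ.translate γ (h i)) x₀) →
      (∀ i < M, NearTerminal (K + 45 * δ) (hρ.translate γ (h i)) (ρ g x₀)) →
      (∀ i < M, NearTerminal (K + 45 * δ) (hρ.translate γ (h i)) (ρ g⁻¹ x₀)) →
      g ∈ badSet S R' q n := by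
  obtain ⟨R₁, hR₁⟩ := hρ.exists_wordLength_le hS h4 hδ hγ
    (T := γ.len - 2 * (K + 45 * δ)) (by linarith) (by linarith) x₀ (D + 1)
  refine ⟨2 * (R₁ + 1), fun g n q M h hg hq hD hfam h0 hg1 hg2 => ?_⟩
  obtain ⟨v, hv0, hvN, hv⟩ := exists_geodesic_word_path hS g
  set N := wordLength S g
  have hD' : 2 * (N + 1) < q * (D + 1) := by omega
  have hv' : ∀ i j, i ≤ j →
      wordLength S ((g⁻¹ * v (N - i))⁻¹ * (g⁻¹ * v (N - j))) ≤ j - i := fun i j hij => by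
    have e : (g⁻¹ * v (N - i))⁻¹ * (g⁻¹ * v (N - j)) = ((v (N - j))⁻¹ * v (N - i))⁻¹ := by group
    rw [e, wordLength_inv hS]
    exact (hv _ _ (by omega)).trans (by omega)
  have hstep : ∀ w : ℕ → G, (∀ i j, i ≤ j → wordLength S ((w i)⁻¹ * w j) ≤ j - i) →
      ∀ j < N, dist (ρ (w j) x₀) (ρ (w (j + 1)) x₀) ≤ Λ := fun w hw j _ => by
    rw [hρ.dist_eq]
    refine (hρ.dist_le_mul_wordLength hS hΛ _).trans ?_
    have : wordLength S ((w j)⁻¹ * w (j + 1)) ≤ 1 := (hw j (j + 1) (by omega)).trans (by omega)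
    calc _ ≤ Λ * (1 : ℕ) := by gcongr
      _ = Λ := by simp
  have hx : IsCrossingPath (K + 45 * δ) Λ M (fun i => hρ.translate γ (h i))
      (fun j => ρ (v j) x₀) N := by
    refine ⟨hstep v hv, fun i hi => ?_, fun i hi => ?_⟩
    · rw [hv0, hρ.one]
      exact h0 i hi
    · rw [hvN]
      exact hg1 i hi
  have hx' : IsCrossingPath (K + 45 * δ) Λ M (fun i => hρ.translate γ (h i))
      (fun j => ρ (g⁻¹ * v (N - j)) x₀) N := by
    refine ⟨hstep (fun j => g⁻¹ * v (N - j)) hv', fun i hi => ?_, fun i hi => ?_⟩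
    · rw [Nat.sub_zero, hvN, inv_mul_cancel, hρ.one]
      exact h0 i hi
    · rw [Nat.sub_self, hv0, mul_one]
      exact hg2 i hi
  obtain ⟨i, hqi, hiq, hc, hc'⟩ := hfam.exists_card_visits_le h4 hδ (by linarith)
    (fun j => ρ (v j) x₀) (fun j => ρ (g⁻¹ * v (N - j)) x₀) N hq hD'
  have hi : i < M := by omega
  obtain ⟨k, hk, hkR⟩ := hρ.exists_wordLength_visit_le hS h4 hδ hΛ0 (by linarith) hR₁ hv hx hi hc
  obtain ⟨k', hk', hkR'⟩ := hρ.exists_wordLength_visit_le hS h4 hδ hΛ0 (by linarith) hR₁ hv' hx'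
    hi hc'
  have hk1 := hx.le_of_mem_visits h4 hδ hΛ0 hfam (by linarith) hi hk
  have hk2 := hx'.le_of_mem_visits h4 hδ hΛ0 hfam (by linarith) hi hk'
  have hkN := (mem_visits.1 hk).1
  have hkN' := (mem_visits.1 hk').1
  set u := (v k)⁻¹ * (g⁻¹ * v (N - k')) with hu
  have huR : wordLength S u⁻¹ ≤ 2 * (R₁ + 1) := by
    have e : u = (v k)⁻¹ * h i * ((g⁻¹ * v (N - k'))⁻¹ * h i)⁻¹ := by rw [hu]; group
    rw [wordLength_inv hS, e]
    refine (wordLength_mul_le hS _ _).trans ?_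
    rw [wordLength_inv hS]
    omega
  have hgu : g = v (N - k') * u⁻¹ * (v k)⁻¹ := by rw [hu]; group
  have hvlen : ∀ j, wordLength S (v j) ≤ j := fun j => by
    have := hv 0 j (Nat.zero_le j)
    simpa [hv0] using this
  rcases le_total k (N - k') with hle | hle
  · refine ⟨v k, (v k)⁻¹ * v (N - k'), u⁻¹, huR, ?_, Or.inl ?_⟩
    · have h1 := hvlen k
      have h2 := hv _ _ hle
      omega
    · rw [mul_inv_cancel_left]
      exact hgu
  · refine ⟨v (N - k'), (v (N - k'))⁻¹ * v k, u⁻¹, huR, ?_, Or.inr ?_⟩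
    · have h1 := hvlen (N - k')
      have h2 := hv _ _ hle
      omega
    · rw [mul_inv_cancel_left]
      exact hgu

end Bad

/-! ### Aligned sequences of translates -/

theorem isChain_cons_map_range_append_iff {α : Type*} {R : α → α → Prop} {a b : α} {f : ℕ → α}
    {m : ℕ} (hm : 0 < m) :
    List.IsChain R ([a] ++ (List.range m).map f ++ [b]) ↔
      R a (f 0) ∧ (∀ i, i + 1 < m → R (f i) (f (i + 1))) ∧ R (f (m - 1)) b := by
  obtain ⟨k, rfl⟩ : ∃ k, m = k + 1 := ⟨m - 1, by omega⟩
  rw [List.append_assoc, List.isChain_append, List.isChain_append, List.isChain_map,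
    List.isChain_range_succ]
  simp only [List.IsChain.singleton, Nat.succ_eq_add_one, List.range_succ, List.map_append,
    List.map_cons, List.map_nil, List.getLast?_append, List.getLast?_singleton, Option.some_or,
    Option.mem_def, Option.some.injEq, List.head?_cons, forall_eq', true_and,
    List.append_assoc, List.cons_append, List.nil_append, List.head?_append, List.head?_map,
    List.head?_range, add_lt_add_iff_right, add_tsub_cancel_right]
  rcases k with _ | k
  · simp
    tauto
  · simp
    tauto

section Aligned

variable {ρ : G → X → X} {S : Finset G} {x₀ : X}

theorem IsIsometricAction.alignedSeq_iff (hρ : IsIsometricAction ρ) {K : ℝ}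
    {γ : GeodesicSegment X} {h : ℕ → G} {m : ℕ} (hm : 0 < m) {x y : X} :
    AlignedSeq K ([GeodesicSegment.point x] ++ transList ρ hρ.isometry γ h m ++
        [GeodesicSegment.point y]) ↔
      AlignedPair K (GeodesicSegment.point x) (hρ.translate γ (h 1)) ∧
      (∀ i, i + 1 < m →
        AlignedPair K (hρ.translate γ (h (i + 1))) (hρ.translate γ (h (i + 2)))) ∧
      AlignedPair K (hρ.translate γ (h m)) (GeodesicSegment.point y) := by
  have key := isChain_cons_map_range_append_iff (R := AlignedPair K)
    (a := GeodesicSegment.point x) (b := GeodesicSegment.point y)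
    (f := fun i => hρ.translate γ (h (i + 1))) hm
  rw [Nat.sub_add_cancel hm] at key
  exact key

theorem IsIsometricAction.translate_reverse_mul (hρ : IsIsometricAction ρ)
    (γ : GeodesicSegment X) (g h : G) : hρ.translate γ.reverse (g * h) =
      ((hρ.translate γ h).translate (ρ g) (hρ.isometry g)).reverse := by
  simp [IsIsometricAction.translate, GeodesicSegment.translate, GeodesicSegment.reverse,
    Function.comp_def, hρ.mul]

theorem GeodesicSegment.mem_seg_point (x : X) : x ∈ (GeodesicSegment.point x).seg := by
  rw [seg_point]
  rfl

/-- If the sequence is aligned for `g` but its middle third does not witness `g ∈ W`, then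
the first third is passed on the way to `g⁻¹ x₀` or the last third is on the way from `g² x₀`. -/
theorem exists_mem_badSet_of_mem_diff (hρ : IsIsometricAction ρ)
    (hS : Subgroup.closure (S : Set G) = ⊤) {δ Λ E0 : ℝ} {R : ℕ} (h4 : FourPoint X δ)
    (hδ : 0 < δ) (hΛ0 : 0 ≤ Λ) (hΛ : ∀ s ∈ S, dist x₀ (ρ s x₀) ≤ Λ) {γ : GeodesicSegment X}
    (hγ : IsRigid S ρ γ E0 R) (hE : 0 ≤ E0)
    (hlen : 2 * (6 * E0 + 300 * δ + 45 * δ) + Λ + E0 + 92 * δ < γ.len) (D : ℕ) :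
    ∃ R' : ℕ, ∀ (ε : ℝ) (n q : ℕ), 0 < ε → 2 ≤ ε * n → 3 * (q : ℝ) ≤ ε * n - 2 →
      2 * (n + 1) < q * (D + 1) →
      Vset S ρ hρ.isometry x₀ δ E0 γ (3 * ε) n \ Wset S ρ hρ.isometry x₀ δ E0 γ ε n ⊆
        badSet S R' q n := by
  obtain ⟨R₁, hR₁⟩ := hρ.exists_mem_badSet hS (x₀ := x₀) (K := 6 * E0 + 300 * δ)
    h4 hδ hΛ0 hΛ hγ hE hlen D
  obtain ⟨R₂, hR₂⟩ := hρ.exists_mem_badSet hS (x₀ := x₀) (K := 6 * E0 + 300 * δ)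
    h4 hδ hΛ0 hΛ hγ.reverse hE hlen D
  refine ⟨max R₁ R₂, ?_⟩
  rintro ε n q hε hεn hqε hD g ⟨⟨hgn, h, hal⟩, hW⟩
  have hgn' : wordLength S g ≤ n := by
    rw [ball_natCast] at hgn
    exact hgn
  set m := ⌈3 * ε * (n : ℝ)⌉₊ with hm
  set m' := ⌈ε * (n : ℝ)⌉₊ with hm'
  have hmle : 3 * ε * n ≤ m := Nat.le_ceil _
  have hm'le : ε * n ≤ m' := Nat.le_ceil _
  have hm'lt : (m' : ℝ) < ε * n + 1 := Nat.ceil_lt_add_one (by positivity)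
  have hm'pos : 0 < m' := by
    have : (0 : ℝ) < m' := by linarith
    exact_mod_cast this
  have hq1 : 3 * q ≤ m' := by
    have : (3 * q : ℝ) ≤ m' := by linarith
    exact_mod_cast this
  have hq2 : 3 * q + 2 * m' ≤ m := by
    have : (3 * q + 2 * m' : ℝ) ≤ m := by linarith
    exact_mod_cast this
  set K := 6 * E0 + 300 * δ with hK
  set c := K + 45 * δ with hc
  have hKpos : 0 < K := by positivity
  obtain ⟨hal0, halp, hal1⟩ := (hρ.alignedSeq_iff (by omega)).1 hal
  set Γ : ℕ → GeodesicSegment X := fun i => hρ.translate γ (h (i + 1)) with hΓ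
  have hfam : IsAlignedFamily K γ.len m Γ := ⟨fun _ _ => rfl, fun i hi => (halp i hi).pairNear⟩
  have hI : ∀ i < m, NearInitial c (Γ i) x₀ := by
    have h0 : NearInitial K (Γ 0) x₀ := hal0.nearInitial (GeodesicSegment.mem_seg_point x₀)
    intro i hi
    rcases Nat.eq_zero_or_pos i with rfl | hpos
    · exact fun t ht => (h0 t ht).trans (by linarith)
    · obtain ⟨a, ha⟩ := exists_isProj (Γ 0) x₀
      exact hfam.nearInitial h4 hδ (by linarith) hpos hi ha (by linarith [h0 a ha])
  have hT : ∀ i < m, NearTerminal c (Γ i) (ρ g x₀) := by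
    have h0 : NearTerminal K (Γ (m - 1)) (ρ g x₀) := by
      have e : m - 1 + 1 = m := by omega
      simp only [hΓ, e]
      exact hal1.nearTerminal (GeodesicSegment.mem_seg_point _)
    have hlenΓ : (Γ (m - 1)).len = γ.len := rfl
    intro i hi
    rcases Nat.lt_or_ge i (m - 1) with hlt | hge
    · obtain ⟨b, hb⟩ := exists_isProj (Γ (m - 1)) (ρ g x₀)
      exact hfam.nearTerminal h4 hδ (by linarith) hlt (by omega) hb (by linarith [h0 b hb])
    · have e : i = m - 1 := by omega
      subst e
      exact fun t ht => le_trans (by linarith) (h0 t ht)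
  by_cases h1 : NearInitial c (Γ m') (ρ g⁻¹ x₀)
  · by_cases h2 : NearTerminal c (Γ (2 * m' - 1)) (ρ (g ^ 2) x₀)
    · refine absurd ⟨hgn, fun j => h (m' + j), ?_, ?_, ?_⟩ hW
      · refine (hρ.alignedSeq_iff hm'pos).2 ⟨?_, fun i hi => ?_, ?_⟩
        · exact (hI m' (by omega)).alignedPair h4 hδ (by linarith) (by linarith)
        · exact (halp (m' + i) (by omega)).mono (by linarith)
        · have e : m' + m' = 2 * m' - 1 + 1 := by omega
          rw [e]
          exact (hT (2 * m' - 1) (by omega)).alignedPair h4 hδ (by linarith) (by linarith)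
      · exact h1.alignedPair h4 hδ (by linarith) (by linarith)
      · have e : m' + m' = 2 * m' - 1 + 1 := by omega
        have key : AlignedPair (6 * E0 + 360 * δ) (hρ.translate γ (h (2 * m' - 1 + 1)))
            (GeodesicSegment.point (ρ (g ^ 2) x₀)) :=
          h2.alignedPair h4 hδ (by linarith) (by linarith)
        rw [← e] at key
        exact key
    · unfold NearTerminal at h2
      push Not at h2
      obtain ⟨a, ha, hlt⟩ := h2
      have hlt' : a < γ.len - c := hlt
      refine badSet_mono (le_max_right R₁ R₂) (inv_mem_badSet hS ?_)
      have hrev : ∀ i < m - 2 * m', hρ.translate γ.reverse (g⁻¹ * h (m - i)) =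
          ((Γ (m - 1 - i)).translate (ρ g⁻¹) (hρ.isometry g⁻¹)).reverse := fun i hi => by
        have e : m - i = m - 1 - i + 1 := by omega
        rw [hρ.translate_reverse_mul, e]
      refine hR₂ g⁻¹ n q (m - 2 * m') (fun i => g⁻¹ * h (m - i))
        (by rwa [wordLength_inv hS]) (by omega) hD ⟨fun _ _ => rfl, fun i hi => ?_⟩
        (fun i hi => ?_) (fun i hi => ?_) (fun i hi => ?_)
      · rw [hrev i (by omega), hrev (i + 1) hi]
        have h3 := hfam.pairNear (m - 1 - (i + 1)) (by omega)
        have e : m - 1 - (i + 1) + 1 = m - 1 - i := by omega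
        rw [e] at h3
        exact (h3.translate _ _).reverse
      · rw [hrev i hi]
        have h3 := (hT (m - 1 - i) (by omega)).translate (ρ g⁻¹) (hρ.isometry g⁻¹)
        rw [← hρ.mul, inv_mul_cancel, hρ.one] at h3
        exact h3.reverse
      · rw [hrev i hi]
        exact ((hI (m - 1 - i) (by omega)).translate (ρ g⁻¹) (hρ.isometry g⁻¹)).reverse
      · rw [hrev i hi]
        have h3 := (hfam.nearInitial h4 hδ (by linarith) (i := 2 * m' - 1) (j := m - 1 - i)
          (by omega) (by omega) ha hlt').translate (ρ g⁻¹) (hρ.isometry g⁻¹)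
        have e : g⁻¹ * g ^ 2 = g⁻¹⁻¹ := by group
        rw [← hρ.mul, e] at h3
        exact h3.reverse
  · unfold NearInitial at h1
    push Not at h1
    obtain ⟨b, hb, hlt⟩ := h1
    refine badSet_mono (le_max_left R₁ R₂) ?_
    exact hR₁ g n q m' (fun i => h (i + 1)) hgn' hq1 hD
      ⟨fun _ _ => rfl, fun i hi => hfam.pairNear i (by omega)⟩
      (fun i hi => hI i (by omega)) (fun i hi => hT i (by omega))
      (fun i hi => hfam.nearTerminal h4 hδ (by linarith) hi (by omega) hb hlt)

end Aligned

theorem exists_mul_pow_le_two_pow_div (C : ℝ) {d : ℕ} (hd : 0 < d) :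
    ∃ lam : ℝ, 1 < lam ∧ ∃ N : ℕ, ∀ n : ℕ, N ≤ n →
      C * ((n + 1) * (n + 1)) * lam ^ n ≤ 2 ^ (n / d) := by
  set lam : ℝ := 2 ^ ((1 : ℝ) / (2 * d : ℕ)) with hlam
  have hlam1 : 1 < lam := Real.one_lt_rpow (by norm_num) (by positivity)
  have hpow : lam ^ (2 * d) = 2 := by
    rw [hlam, one_div]
    exact Real.rpow_inv_natCast_pow (by norm_num) (by omega)
  have hlim := (tendsto_pow_const_div_const_pow_of_one_lt 2 hlam1).const_mul (8 * |C|)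
  rw [mul_zero] at hlim
  obtain ⟨N, hN⟩ := Filter.eventually_atTop.1 (hlim.eventually_le_const (zero_lt_one))
  refine ⟨lam, hlam1, max N 1, fun n hn => ?_⟩
  have h1 := hN n (le_of_max_le_left hn)
  have hn1 : (1 : ℝ) ≤ n := by exact_mod_cast le_of_max_le_right hn
  have hpos : 0 < lam ^ n := by positivity
  rw [← mul_div_assoc, div_le_one hpos] at h1
  have h2 : 2 * (C * ((n + 1) * (n + 1))) ≤ lam ^ n := by
    refine le_trans ?_ h1
    have h3 : ((n : ℝ) + 1) * (n + 1) ≤ 4 * (n : ℝ) ^ 2 := by nlinarith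
    calc 2 * (C * ((n + 1) * (n + 1))) ≤ 2 * (|C| * (4 * (n : ℝ) ^ 2)) := by
          gcongr
          exact le_abs_self C
      _ = _ := by ring
  have h3 : lam ^ n * lam ^ n ≤ 2 * 2 ^ (n / d) := by
    rw [← pow_add, ← pow_succ', ← hpow, ← pow_mul]
    refine pow_le_pow_right₀ hlam1.le ?_
    have h5 := Nat.lt_mul_div_succ n hd
    rw [mul_assoc]
    omega
  nlinarith

/-- Lemma 4.6: `V_{L,3ε}(n) \ W_{L,ε}(n)` is exponentially non-generic. -/
theorem V_minus_W_density {G : Type*} [Group G] {X : Type*} [MetricSpace X]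
    (S : Finset G) (hSgen : Subgroup.closure (S : Set G) = ⊤)
    (hNVC : NonVirtuallyCyclic G)
    (δ : ℝ) (hδ : 0 < δ) (hgeo : IsGeodesicSpace X) (hhyp : IsDeltaHyperbolic X δ)
    (ρ : G → X → X) (hisom : ∀ g : G, Isometry (ρ g))
    (hmul : ∀ g h : G, ∀ x : X, ρ (g * h) x = ρ g (ρ h x)) (hone : ∀ x : X, ρ 1 x = x)
    (x0 : X) (φ : G)
    (hlox : IsLoxodromic ρ x0 φ) (hwpd : HasWPD ρ x0 φ)
    (E0 : ℝ) (hE0 : E0Spec S ρ x0 φ E0) :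
    ∃ L1 : ℝ, 0 < L1 ∧ ∀ L : ℕ, L1 < (L : ℝ) →
      ∀ Υ : GeodesicSegment X, Υ.initial = x0 → Υ.terminal = ρ (φ ^ L) x0 →
      ∀ ε : ℝ, 0 < ε → ∃ lam : ℝ, 1 < lam ∧ ∃ N : ℕ, ∀ n : ℕ, N ≤ n →
        (((Vset S ρ hisom x0 δ E0 Υ (3 * ε) n \ Wset S ρ hisom x0 δ E0 Υ ε n).ncard : ℝ) /
            ((ball S (n:ℝ)).ncard : ℝ))
          ≤ (lam ^ n)⁻¹ := by
  have hρ : IsIsometricAction ρ := ⟨hisom, hmul, hone⟩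
  have h4 := hhyp.fourPoint hδ hgeo
  have hE := hE0.1
  set Λ := ∑ s ∈ S, dist x0 (ρ s x0) with hΛdef
  have hΛ0 : 0 ≤ Λ := Finset.sum_nonneg fun _ _ => dist_nonneg
  have hΛ : ∀ s ∈ S, dist x0 (ρ s x0) ≤ Λ := fun s hs =>
    Finset.single_le_sum (f := fun s => dist x0 (ρ s x0)) (fun _ _ => dist_nonneg) hs
  obtain ⟨N₀, hN₀⟩ := Filter.eventually_atTop.1 (hlox.tendsto_dist.eventually_gt_atTop
    (2 * (6 * E0 + 300 * δ + 45 * δ) + Λ + E0 + 92 * δ))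
  refine ⟨N₀ + 1, by positivity, fun L hL Υ h0 h1 ε hε => ?_⟩
  have hL' : N₀ + 1 < L := by exact_mod_cast hL
  have hlen : 2 * (6 * E0 + 300 * δ + 45 * δ) + Λ + E0 + 92 * δ < Υ.len := by
    rw [← Υ.dist_initial_terminal, h0, h1]
    exact hN₀ L (by omega)
  have hrig := hE0.isRigid hρ hSgen (by omega) h0 h1
  obtain ⟨A, c, hA, hgrow⟩ := hρ.ncard_mul_ncard_le hSgen h4 hδ hE0 hΛ0 hΛ (by omega) h0 h1
    (by linarith)
  obtain ⟨k₀, hk₀, hdouble⟩ := two_mul_ncard_wordBall_le hSgen hNVC (hlox.injective_pow hone)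
    hA hgrow
  set η := min ε 1 / 4 with hη
  have hηpos : 0 < η := by positivity
  have hη1 : η ≤ ε / 4 := by
    have := min_le_left ε 1
    linarith
  have hη2 : η ≤ 1 / 4 := by
    have := min_le_right ε 1
    linarith
  obtain ⟨R', hR'⟩ := exists_mem_badSet_of_mem_diff hρ hSgen h4 hδ hΛ0 hΛ hrig hE.le hlen
    ⌈8 / η⌉₊
  set d := ⌈2 * k₀ / η⌉₊ with hd
  have hdpos : 0 < d := Nat.ceil_pos.2 (by positivity)
  obtain ⟨lam, hlam, N₁, hN₁⟩ :=
    exists_mul_pow_le_two_pow_div (2 * (wordBall S R').ncard * A : ℝ) hdpos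
  refine ⟨lam, hlam, max N₁ ⌈2 * (c + 2) / η⌉₊, fun n hn => ?_⟩
  have hn1 := hN₁ n (le_of_max_le_left hn)
  have hn2 : 2 * (c + 2) ≤ η * n := by
    have := (Nat.le_ceil _).trans (Nat.cast_le (α := ℝ).2 (le_of_max_le_right hn))
    rwa [div_le_iff₀' hηpos] at this
  have hc0 : (0 : ℝ) ≤ c := Nat.cast_nonneg c
  set q := ⌊η * n⌋₊ with hq
  have hqle : (q : ℝ) ≤ η * n := Nat.floor_le (by positivity)
  have hqlt : η * n < q + 1 := Nat.lt_floor_add_one _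
  have hεn : 4 * (η * n) ≤ ε * n := by
    have := mul_le_mul_of_nonneg_right hη1 (Nat.cast_nonneg (α := ℝ) n)
    linarith
  have hηn : 4 * (η * n) ≤ n := by
    have := mul_le_mul_of_nonneg_right hη2 (Nat.cast_nonneg (α := ℝ) n)
    linarith
  have hqn : q ≤ n := by
    have : (q : ℝ) ≤ n := by linarith
    exact_mod_cast this
  have hD : 2 * (n + 1) < q * (⌈8 / η⌉₊ + 1) := by
    have h2 : 8 / η ≤ ⌈8 / η⌉₊ := Nat.le_ceil _
    have h3 : 2 * ((n : ℝ) + 1) < q * (⌈8 / η⌉₊ + 1) := by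
      calc 2 * ((n : ℝ) + 1) < (η * n / 2) * (8 / η) := by
            field_simp
            linarith
        _ ≤ q * (⌈8 / η⌉₊ + 1) := by
            gcongr
            · linarith
            · linarith
    exact_mod_cast h3
  have hsub := hR' ε n q hε (by linarith) (by linarith) hD
  obtain ⟨hfin, hcard⟩ := finite_badSet_and_ncard_le hSgen hgrow R' hqn
  have hp : n / d * k₀ + c ≤ q := by
    have h2 : 2 * k₀ / η ≤ d := Nat.le_ceil _
    rw [div_le_iff₀ hηpos] at h2
    have h3 : ((n / d : ℕ) : ℝ) * d ≤ n := by exact_mod_cast Nat.div_mul_le_self n d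
    have h5 : ((n / d : ℕ) : ℝ) * (2 * k₀) ≤ η * n := by
      calc ((n / d : ℕ) : ℝ) * (2 * k₀) ≤ (n / d : ℕ) * (d * η) := by gcongr
        _ = η * ((n / d : ℕ) * d) := by ring
        _ ≤ η * n := by gcongr
    have h6 : ((n / d : ℕ) : ℝ) * k₀ + c ≤ q := by linarith
    exact_mod_cast h6
  have hballs : 2 ^ (n / d) * (wordBall S (n - q + c)).ncard ≤ (wordBall S n).ncard :=
    (hdouble _ _).trans (Set.ncard_le_ncard (wordBall_mono (by omega)) (finite_wordBall hSgen n))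
  have hV := (Set.ncard_le_ncard hsub hfin).trans hcard
  rw [ball_natCast]
  have hBpos : (0 : ℝ) < (wordBall S n).ncard := by
    exact_mod_cast one_le_ncard_wordBall hSgen n
  have hlampos : 0 < lam ^ n := by positivity
  rw [div_le_iff₀ hBpos, inv_mul_eq_div, le_div_iff₀ hlampos]
  calc _ ≤ ((2 * (wordBall S R').ncard * A * ((n + 1) * (n + 1)) *
        (wordBall S (n - q + c)).ncard : ℕ) : ℝ) * lam ^ n := by
        gcongr
    _ = 2 * (wordBall S R').ncard * A * ((n + 1) * (n + 1)) * lam ^ n *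
        (wordBall S (n - q + c)).ncard := by
        push_cast
        ring
    _ ≤ 2 ^ (n / d) * (wordBall S (n - q + c)).ncard := by gcongr
    _ ≤ (wordBall S n).ncard := by exact_mod_cast hballs

end AcylCount
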